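/- Let A and B be separable C*-algebras with A homotopy dominated by B, and let D be a C*-algebra with closed two-sided ideal I and quotient map q: D → D/I. Suppose that every *-homomorphism from B to D/I that has a cp lift to D lifts to a cp (discrete) asymptotic homomorphism from B to D. Then every *-homomorphism from A to D/I that has a cp lift to D lifts to a cp (discrete) asymptotic homomorphism from A to D. -/

import Mathlib

open Filter Topology

noncomputable section

/-- A map between C*-algebras is completely positive: it is linear and its amplification to
every matrix level maps positive elements to positive elements. -/
def IsCompletelyPositive {A B : Type*} [NonUnitalCStarAlgebra A] [NonUnitalCStarAlgebra B]
    (φ : A → B) : Prop :=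
  (∀ a b, φ (a + b) = φ a + φ b) ∧ (∀ (c : ℂ) (a : A), φ (c • a) = c • φ a) ∧
  ∀ (k : ℕ) (x : Matrix (Fin k) (Fin k) A),
    (∃ y : Matrix (Fin k) (Fin k) A, x = star y * y) →
    ∃ z : Matrix (Fin k) (Fin k) B, x.map φ = star z * z

/-- A (continuous) asymptotic homomorphism between C*-algebras, indexed by `ℝ≥0 = [0,∞)`. -/
def IsAsymptoticHom {A B : Type*} [NonUnitalCStarAlgebra A] [NonUnitalCStarAlgebra B]
    (f : NNReal → A → B) : Prop :=
  (∀ a : A, Continuous fun t => f t a) ∧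
  (∀ a b : A, Tendsto (fun t => ‖f t (a * b) - f t a * f t b‖) atTop (𝓝 0)) ∧
  (∀ (μ₁ μ₂ : ℂ) (a b : A),
    Tendsto (fun t => ‖f t (μ₁ • a + μ₂ • b) - (μ₁ • f t a + μ₂ • f t b)‖) atTop (𝓝 0)) ∧
  (∀ a : A, Tendsto (fun t => ‖f t (star a) - star (f t a)‖) atTop (𝓝 0))

/-- A discrete asymptotic homomorphism between C*-algebras, indexed by `ℕ`. -/
def IsDiscreteAsymptoticHom {A B : Type*} [NonUnitalCStarAlgebra A] [NonUnitalCStarAlgebra B]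
    (f : ℕ → A → B) : Prop :=
  (∀ a b : A, Tendsto (fun n => ‖f n (a * b) - f n a * f n b‖) atTop (𝓝 0)) ∧
  (∀ (μ₁ μ₂ : ℂ) (a b : A),
    Tendsto (fun n => ‖f n (μ₁ • a + μ₂ • b) - (μ₁ • f n a + μ₂ • f n b)‖) atTop (𝓝 0)) ∧
  (∀ a : A, Tendsto (fun n => ‖f n (star a) - star (f n a)‖) atTop (𝓝 0)) ∧
  (∀ a : A, ∃ C : ℝ, ∀ n, ‖f n a‖ ≤ C)

/-- Two ∗-homomorphisms `φ, ψ : B → A` are homotopic. -/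
def AreHomotopic {B A : Type*} [NonUnitalCStarAlgebra A] [NonUnitalCStarAlgebra B]
    (φ ψ : B →⋆ₙₐ[ℂ] A) : Prop :=
  ∃ Φ : B →⋆ₙₐ[ℂ] C(unitInterval, A), (∀ b, Φ b 0 = ψ b) ∧ (∀ b, Φ b 1 = φ b)


lemma norm_add_sq_le_of_star_mul {U : Type*} [CStarAlgebra U] (d d' : U) :
    ‖d + d'‖ ^ 2 ≤ ‖d‖ ^ 2 + ‖d'‖ ^ 2 + 2 * ‖star d * d'‖ := by
  have e : star (d + d') * (d + d') =
      star d * d + star d' * d' + (star d * d' + star (star d * d')) := by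
    simp only [star_add, star_mul, star_star]
    noncomm_ring
  calc ‖d + d'‖ ^ 2 = ‖star (d + d') * (d + d')‖ := by rw [sq, CStarRing.norm_star_mul_self]
    _ ≤ ‖star d * d‖ + ‖star d' * d'‖ + (‖star d * d'‖ + ‖star (star d * d')‖) := by
      rw [e]
      exact (norm_add_le _ _).trans (add_le_add (norm_add_le _ _) (norm_add_le _ _))
    _ = _ := by
      rw [CStarRing.norm_star_mul_self, CStarRing.norm_star_mul_self, norm_star]
      ring

lemma norm_star_commutator_mul_commutator_le {U : Type*} [CStarAlgebra U]
    {s u z : U} (hs : IsSelfAdjoint s) {η : ℝ}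
    (h1 : ‖s - s * u‖ ≤ η) (h2 : ‖s * z - s * z * u‖ ≤ η)
    (h3 : ‖s * star z - s * star z * u‖ ≤ η)
    (h4 : ‖s * star z * z - s * star z * z * u‖ ≤ η) :
    ‖star (s * z - z * s) * (u * z - z * u)‖ ≤ (1 + ‖z‖) ^ 2 * η := by
  have e : star (s * z - z * s) * (u * z - z * u) =
      -(star z * (s - s * u) * z) + star z * (s * z - s * z * u) + (s * star z - s * star z * u) * z
        - (s * star z * z - s * star z * z * u) := by
    simp only [star_sub, star_mul, hs.star_eq]
    noncomm_ring
  have hz := norm_nonneg z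
  have b1 : ‖star z * (s - s * u) * z‖ ≤ ‖z‖ * η * ‖z‖ := by
    refine (norm_mul_le _ _).trans (mul_le_mul_of_nonneg_right ((norm_mul_le _ _).trans ?_) hz)
    rw [norm_star]
    gcongr
  have b2 : ‖star z * (s * z - s * z * u)‖ ≤ ‖z‖ * η := by
    refine (norm_mul_le _ _).trans ?_
    rw [norm_star]
    gcongr
  have b3 : ‖(s * star z - s * star z * u) * z‖ ≤ η * ‖z‖ :=
    (norm_mul_le _ _).trans (by gcongr)
  rw [e]
  refine (norm_sub_le _ _).trans ((add_le_add ((norm_add_le _ _).trans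
    (add_le_add ((norm_add_le _ _).trans (add_le_add (norm_neg _).le le_rfl)) le_rfl)) le_rfl).trans
      ?_)
  nlinarith

section Quasicentral

variable {U V : Type*} [CStarAlgebra U] [CStarAlgebra V]

open scoped CStarAlgebra in
lemma map_cfc_of_map_eq_zero {π : U →⋆ₐ[ℂ] V} {b : U} (hb : IsSelfAdjoint b) (h0 : π b = 0)
    {f : ℝ → ℝ} (hf : ContinuousOn f (spectrum ℝ b)) : π (cfc f b) = algebraMap ℝ V (f 0) := by
  rw [StarAlgHomClass.map_cfc π f b (hφa := hb.map π), h0, cfc_apply_zero]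

variable [PartialOrder U]

/-- The positive contractions in the kernel of `π`. -/
def kerPosContraction (π : U →⋆ₐ[ℂ] V) : Set U := {e | 0 ≤ e ∧ e ≤ 1 ∧ π e = 0}

/-- The positive contractions in the kernel of `π` that almost commute with the elements of `Z` and
are almost a right unit on those elements of `Z` that lie in the kernel. -/
def quasicentralSet (π : U →⋆ₐ[ℂ] V) (p : Finset U × ℕ) : Set U :=
  {e | e ∈ kerPosContraction π ∧ (∀ z ∈ p.1, ‖e * z - z * e‖ ≤ 1 / (p.2 + 1)) ∧
    ∀ z ∈ p.1, π z = 0 → ‖z - z * e‖ ≤ 1 / (p.2 + 1)}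

lemma quasicentralSet_anti (π : U →⋆ₐ[ℂ] V) : Antitone (quasicentralSet π) := by
  intro p p' h e he
  have h2 : (1 : ℝ) / (p'.2 + 1) ≤ 1 / (p.2 + 1) := by
    have : (p.2 : ℝ) ≤ p'.2 := by exact_mod_cast h.2
    gcongr
  exact ⟨he.1, fun z hz => (he.2.1 z (h.1 hz)).trans h2,
    fun z hz h0 => (he.2.2 z (h.1 hz) h0).trans h2⟩

/-- A quasicentral approximate unit of the kernel of `π`, as a filter. -/
def quasicentralFilter (π : U →⋆ₐ[ℂ] V) : Filter U := ⨅ p, 𝓟 (quasicentralSet π p)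

lemma hasBasis_quasicentralFilter (π : U →⋆ₐ[ℂ] V) :
    (quasicentralFilter π).HasBasis (fun _ => True) (quasicentralSet π) := by
  classical
  exact hasBasis_iInf_principal (quasicentralSet_anti π).directed_ge

lemma eventually_mem_kerPosContraction (π : U →⋆ₐ[ℂ] V) :
    ∀ᶠ e in quasicentralFilter π, e ∈ kerPosContraction π :=
  mem_of_superset ((hasBasis_quasicentralFilter π).mem_of_mem (i := (∅, 0)) trivial)
    fun _ he => he.1

lemma tendsto_commutator_quasicentralFilter (π : U →⋆ₐ[ℂ] V) (z : U) :
    Tendsto (fun e => e * z - z * e) (quasicentralFilter π) (𝓝 0) := by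
  rw [(hasBasis_quasicentralFilter π).tendsto_iff Metric.nhds_basis_ball]
  intro ε hε
  obtain ⟨n, hn⟩ := exists_nat_one_div_lt hε
  exact ⟨({z}, n), trivial, fun e he => by
    simpa using (he.2.1 z (by simp)).trans_lt hn⟩

lemma tendsto_mul_quasicentralFilter (π : U →⋆ₐ[ℂ] V) {z : U} (hz : π z = 0) :
    Tendsto (fun e => z * e) (quasicentralFilter π) (𝓝 z) := by
  rw [(hasBasis_quasicentralFilter π).tendsto_iff Metric.nhds_basis_ball]
  intro ε hε
  obtain ⟨n, hn⟩ := exists_nat_one_div_lt hε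
  exact ⟨({z}, n), trivial, fun e he => by
    rw [Metric.mem_ball, dist_comm, dist_eq_norm]
    exact (he.2.2 z (by simp) hz).trans_lt hn⟩

variable [StarOrderedRing U]

lemma convex_kerPosContraction (π : U →⋆ₐ[ℂ] V) : Convex ℝ (kerPosContraction π) := by
  intro x hx y hy a b ha hb hab
  refine ⟨add_nonneg (smul_nonneg ha hx.1) (smul_nonneg hb hy.1), ?_, ?_⟩
  · calc a • x + b • y ≤ a • (1 : U) + b • (1 : U) :=
        add_le_add (smul_le_smul_of_nonneg_left hx.2.1 ha) (smul_le_smul_of_nonneg_left hy.2.1 hb)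
      _ = 1 := by rw [← add_smul, hab, one_smul]
  · rw [map_add, ← Complex.coe_smul a x, ← Complex.coe_smul b y, map_smul, map_smul,
      hx.2.2, hy.2.2]
    simp

lemma spectrum_subset_of_mem_kerPosContraction {π : U →⋆ₐ[ℂ] V} {e : U}
    (he : e ∈ kerPosContraction π) : spectrum ℝ e ⊆ Set.Icc 0 1 := by
  intro x hx
  refine ⟨spectrum_nonneg_of_nonneg he.1 hx, ?_⟩
  have h1 : e ≤ algebraMap ℝ U 1 := by simpa using he.2.1
  exact (le_algebraMap_iff_spectrum_le (ha := .of_nonneg he.1)).1 h1 x hx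

lemma norm_le_one_of_mem_kerPosContraction {π : U →⋆ₐ[ℂ] V} {e : U}
    (he : e ∈ kerPosContraction π) : ‖e‖ ≤ 1 :=
  (CStarAlgebra.norm_le_one_iff_of_nonneg e he.1).2 he.2.1

lemma exists_approxUnit_ker (π : U →⋆ₐ[ℂ] V) (Y : Finset U) (hY : ∀ y ∈ Y, π y = 0)
    {ε : ℝ} (hε : 0 < ε) : ∃ e ∈ kerPosContraction π, ∀ y ∈ Y, ‖y - y * e‖ ≤ ε := by
  set b : U := ∑ y ∈ Y, star y * y with hb
  have hb0 : 0 ≤ b := Finset.sum_nonneg fun y _ => star_mul_self_nonneg y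
  have hbs : IsSelfAdjoint b := .of_nonneg hb0
  have hπb : π b = 0 := by
    rw [hb, map_sum]
    exact Finset.sum_eq_zero fun y hy => by rw [map_mul, hY y hy, mul_zero]
  set δ : ℝ := ε ^ 2 with hδ
  have hδ0 : 0 < δ := by positivity
  have hsp : ∀ t ∈ spectrum ℝ b, 0 ≤ t := fun t ht => spectrum_nonneg_of_nonneg hb0 ht
  have hne : ∀ t ∈ spectrum ℝ b, δ + t ≠ 0 := fun t ht => by have := hsp t ht; positivity
  have hc1 : ContinuousOn (fun t : ℝ => t / (δ + t)) (spectrum ℝ b) :=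
    ContinuousOn.div (by fun_prop) (by fun_prop) hne
  have hc2 : ContinuousOn (fun t : ℝ => δ / (δ + t)) (spectrum ℝ b) :=
    ContinuousOn.div (by fun_prop) (by fun_prop) hne
  have h1e : 1 - cfc (fun t : ℝ => t / (δ + t)) b = cfc (fun t : ℝ => δ / (δ + t)) b := by
    rw [← cfc_const_one ℝ b, ← cfc_sub (fun _ => (1 : ℝ)) _ b]
    refine cfc_congr fun t ht => ?_
    have := hne t ht
    field_simp
    ring
  have hf0 : IsSelfAdjoint (cfc (fun t : ℝ => δ / (δ + t)) b) := cfc_predicate _ b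
  refine ⟨cfc (fun t : ℝ => t / (δ + t)) b, ⟨?_, ?_, ?_⟩, ?_⟩
  · exact cfc_nonneg fun t ht => by have := hsp t ht; positivity
  · refine cfc_le_one _ _ fun t ht => ?_
    have := hsp t ht
    rw [div_le_one (by positivity)]
    linarith
  · rw [map_cfc_of_map_eq_zero hbs hπb hc1]
    simp
  · intro y hy
    set f := cfc (fun t : ℝ => δ / (δ + t)) b with hf
    have e1 : y - y * cfc (fun t : ℝ => t / (δ + t)) b = y * f := by rw [← h1e, mul_sub, mul_one]
    rw [e1]
    have e2 : ‖y * f‖ ^ 2 = ‖f * (star y * y) * f‖ := by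
      rw [sq, ← CStarRing.norm_star_mul_self, star_mul, hf0.star_eq]
      simp only [mul_assoc]
    have e3 : f * (star y * y) * f ≤ f * b * f := by
      have : star y * y ≤ b :=
        Finset.single_le_sum (f := fun y => star y * y) (fun y _ => star_mul_self_nonneg y) hy
      simpa [hf0.star_eq] using star_left_conjugate_le_conjugate this f
    have e4 : 0 ≤ f * (star y * y) * f := by
      simpa [hf0.star_eq] using star_left_conjugate_nonneg (star_mul_self_nonneg y) f
    have e5 : ‖f * b * f‖ ≤ δ := by
      have : f * b * f = cfc (fun t : ℝ => δ / (δ + t) * t * (δ / (δ + t))) b := by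
        rw [cfc_mul (fun t : ℝ => δ / (δ + t) * t) (fun t => δ / (δ + t)) b
          (hc2.mul continuousOn_id) hc2,
          cfc_mul (fun t : ℝ => δ / (δ + t)) (fun t => t) b hc2 continuousOn_id, cfc_id' ℝ b]
      rw [this]
      refine norm_cfc_le hδ0.le fun t ht => ?_
      have := hsp t ht
      rw [Real.norm_of_nonneg (by positivity)]
      have h1 : δ / (δ + t) * t ≤ δ := by
        rw [div_mul_eq_mul_div, div_le_iff₀ (by positivity)]
        nlinarith
      have h2 : δ / (δ + t) ≤ 1 := by
        rw [div_le_one (by positivity)]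
        linarith
      calc _ ≤ δ * 1 := mul_le_mul h1 h2 (by positivity) hδ0.le
        _ = δ := mul_one _
    have e6 : ‖y * f‖ ^ 2 ≤ ε ^ 2 := by
      rw [e2]
      exact (CStarAlgebra.norm_le_norm_of_nonneg_of_le e4 e3).trans e5
    exact le_of_sq_le_sq e6 hε.le

lemma exists_sum_almost_central (π : U →⋆ₐ[ℂ] V) (Z Y : Finset U) (hY : ∀ y ∈ Y, π y = 0)
    {ε : ℝ} (hε : 0 < ε) (N : ℕ) :
    ∃ s : U, 0 ≤ s ∧ s ≤ (N : ℝ) • (1 : U) ∧ π s = 0 ∧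
      (∀ z ∈ Z, ‖s * z - z * s‖ ^ 2 ≤ N * (4 * ‖z‖ ^ 2 + 1)) ∧
      ∀ y ∈ Y, ‖(N : ℝ) • y - y * s‖ ≤ N * ε := by
  classical
  induction N with
  | zero => exact ⟨0, by simp⟩
  | succ N ih =>
    obtain ⟨s, hs0, hs1, hπs, hsZ, hsY⟩ := ih
    have hss : IsSelfAdjoint s := .of_nonneg hs0
    set C : ℝ := ∑ z ∈ Z, ‖z‖ with hC
    have hC0 : 0 ≤ C := Finset.sum_nonneg fun z _ => norm_nonneg z
    have hzC : ∀ z ∈ Z, ‖z‖ ≤ C := fun z hz =>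
      Finset.single_le_sum (f := fun z => ‖z‖) (fun z _ => norm_nonneg z) hz
    set η : ℝ := min ε (1 / (2 * (1 + C) ^ 2)) with hη
    have hη0 : 0 < η := lt_min hε (by positivity)
    set W : Finset U := Y ∪ ({s} ∪ (Z.image (fun z => s * z) ∪ (Z.image (fun z => s * star z) ∪
      Z.image (fun z => s * star z * z)))) with hW
    obtain ⟨u, hu, huW⟩ := exists_approxUnit_ker π W (by
      intro y hy
      simp only [hW, Finset.mem_union, Finset.mem_singleton, Finset.mem_image] at hy
      rcases hy with hy | rfl | ⟨z, -, rfl⟩ | ⟨z, -, rfl⟩ | ⟨z, -, rfl⟩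
      · exact hY y hy
      · exact hπs
      all_goals simp [hπs]) hη0
    simp only [hW, Finset.mem_union, Finset.mem_singleton, Finset.mem_image] at huW
    have hn1 := norm_le_one_of_mem_kerPosContraction hu
    refine ⟨s + u, add_nonneg hs0 hu.1, ?_, by rw [map_add, hπs, hu.2.2, add_zero], ?_, ?_⟩
    · rw [Nat.cast_succ, add_smul, one_smul]
      exact add_le_add hs1 hu.2.1
    · intro z hz
      have key := norm_star_commutator_mul_commutator_le (z := z) hss
        (huW s (by simp)) (huW (s * z) (by grind)) (huW (s * star z) (by grind))
        (huW (s * star z * z) (by grind))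
      have key2 : 2 * ‖star (s * z - z * s) * (u * z - z * u)‖ ≤ 1 := by
        have h1 : (1 + ‖z‖) ^ 2 * η ≤ (1 + C) ^ 2 * (1 / (2 * (1 + C) ^ 2)) := by
          have := hzC z hz
          gcongr
          exact min_le_right _ _
        have h2 : (1 + C) ^ 2 * (1 / (2 * (1 + C) ^ 2)) = 1 / 2 := by field_simp
        linarith
      have hd : ‖u * z - z * u‖ ≤ 2 * ‖z‖ := by
        refine (norm_sub_le _ _).trans ?_
        have := norm_mul_le u z
        have := norm_mul_le z u
        nlinarith [norm_nonneg z]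
      have hd2 : ‖u * z - z * u‖ ^ 2 ≤ 4 * ‖z‖ ^ 2 := by
        nlinarith [norm_nonneg (u * z - z * u)]
      have e : (s + u) * z - z * (s + u) = (s * z - z * s) + (u * z - z * u) := by noncomm_ring
      rw [e]
      refine (norm_add_sq_le_of_star_mul _ _).trans ?_
      have := hsZ z hz
      push_cast
      linarith
    · intro y hy
      have e : ((N + 1 : ℕ) : ℝ) • y - y * (s + u) = ((N : ℝ) • y - y * s) + (y - y * u) := by
        rw [Nat.cast_succ, add_smul, one_smul, mul_add]
        abel
      rw [e]
      refine (norm_add_le _ _).trans ?_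
      have h1 := hsY y hy
      have h2 := (huW y (.inl hy)).trans (min_le_left _ _)
      push_cast
      linarith

lemma convex_quasicentralSet (π : U →⋆ₐ[ℂ] V) (p : Finset U × ℕ) :
    Convex ℝ (quasicentralSet π p) := by
  have key : ∀ (x y : U) (a b c : ℝ), 0 ≤ a → 0 ≤ b → a + b = 1 → ‖x‖ ≤ c → ‖y‖ ≤ c →
      ‖a • x + b • y‖ ≤ c := fun x y a b c ha hb hab hx hy => by
    have := convex_closedBall (0 : U) c (mem_closedBall_zero_iff.2 hx)
      (mem_closedBall_zero_iff.2 hy) ha hb hab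
    exact mem_closedBall_zero_iff.1 this
  intro x hx y hy a b ha hb hab
  refine ⟨convex_kerPosContraction π hx.1 hy.1 ha hb hab, fun z hz => ?_, fun z hz h0 => ?_⟩
  · have := key _ _ a b _ ha hb hab (hx.2.1 z hz) (hy.2.1 z hz)
    convert this using 2
    simp only [add_mul, mul_add, smul_mul_assoc, mul_smul_comm, smul_sub]
    abel
  · have := key _ _ a b _ ha hb hab (hx.2.2 z hz h0) (hy.2.2 z hz h0)
    convert this using 2
    have : z = a • z + b • z := by rw [← add_smul, hab, one_smul]
    nth_rewrite 1 [this]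
    simp only [mul_add, mul_smul_comm, smul_sub]
    abel

lemma quasicentralSet_nonempty (π : U →⋆ₐ[ℂ] V) (p : Finset U × ℕ) :
    (quasicentralSet π p).Nonempty := by
  classical
  obtain ⟨Z, n⟩ := p
  set δ : ℝ := 1 / (n + 1) with hδ
  have hδ0 : 0 < δ := by positivity
  set C : ℝ := ∑ z ∈ Z, (4 * ‖z‖ ^ 2 + 1) with hC
  have hzC : ∀ z ∈ Z, 4 * ‖z‖ ^ 2 + 1 ≤ C := fun z hz =>
    Finset.single_le_sum (f := fun z : U => 4 * ‖z‖ ^ 2 + 1) (fun z _ => by positivity) hz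
  obtain ⟨N, hN⟩ := exists_nat_gt (C / δ ^ 2)
  have hC0 : 0 ≤ C := Finset.sum_nonneg fun z _ => by positivity
  have hN0 : (0 : ℝ) < N := lt_of_le_of_lt (by positivity) hN
  obtain ⟨s, hs0, hs1, hπs, hsZ, hsY⟩ := exists_sum_almost_central π Z (Z.filter fun z => π z = 0)
    (fun y hy => (Finset.mem_filter.1 hy).2) hδ0 N
  have hinv : ‖(N : ℝ)⁻¹‖ = (N : ℝ)⁻¹ := Real.norm_of_nonneg (by positivity)
  refine ⟨(N : ℝ)⁻¹ • s, ⟨smul_nonneg (by positivity) hs0, ?_, ?_⟩, fun z hz => ?_,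
    fun z hz h0 => ?_⟩
  · have := smul_le_smul_of_nonneg_left hs1 (inv_nonneg.2 hN0.le)
    rwa [smul_smul, inv_mul_cancel₀ hN0.ne', one_smul] at this
  · rw [← Complex.coe_smul, map_smul, hπs, smul_zero]
  · rw [smul_mul_assoc, mul_smul_comm, ← smul_sub, norm_smul, hinv, inv_mul_le_iff₀ hN0]
    refine le_of_sq_le_sq ?_ (by positivity)
    refine (hsZ z hz).trans ?_
    have h1 : C < N * δ ^ 2 := by rwa [div_lt_iff₀ (by positivity)] at hN
    have h2 := hzC z hz
    calc (N : ℝ) * (4 * ‖z‖ ^ 2 + 1) ≤ N * (N * δ ^ 2) := by gcongr; linarith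
      _ = (N * δ) ^ 2 := by ring
  · have e : z - z * ((N : ℝ)⁻¹ • s) = (N : ℝ)⁻¹ • ((N : ℝ) • z - z * s) := by
      rw [smul_sub, smul_smul, inv_mul_cancel₀ hN0.ne', one_smul, mul_smul_comm]
    rw [e, norm_smul, hinv, inv_mul_le_iff₀ hN0]
    exact hsY z (Finset.mem_filter.2 ⟨hz, h0⟩)

/-- A property that is stable under uniform limits of the functional calculus holds for all
continuous functions as soon as it holds for polynomials. -/
lemma tendsto_of_forall_polynomial {l : Filter U} {π : U →⋆ₐ[ℂ] V}
    (hl : ∀ᶠ e in l, e ∈ kerPosContraction π) {L : U →ₗ[ℝ] U} {κ : ℝ}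
    (hL : ∀ x, ‖L x‖ ≤ κ * ‖x‖) {z : U}
    (hp : ∀ p : Polynomial ℝ, Tendsto (fun e => L (Polynomial.aeval e p) - p.eval 1 • z) l (𝓝 0))
    {f : ℝ → ℝ} (hf : ContinuousOn f (Set.Icc 0 1)) :
    Tendsto (fun e => L (cfc f e) - f 1 • z) l (𝓝 0) := by
  have hκ : 0 < |κ| + ‖z‖ + 1 := by positivity
  rw [NormedAddGroup.tendsto_nhds_zero]
  intro ε hε
  set δ := ε / (2 * (|κ| + ‖z‖ + 1)) with hδ
  have hδ0 : 0 < δ := by positivity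
  obtain ⟨p, hpf⟩ := exists_polynomial_near_of_continuousOn 0 1 f hf δ hδ0
  filter_upwards [hl, (NormedAddGroup.tendsto_nhds_zero.1 (hp p)) (ε / 2) (by positivity)]
    with e he hpe
  have hes : IsSelfAdjoint e := .of_nonneg he.1
  have hsp := spectrum_subset_of_mem_kerPosContraction he
  have h1 : ‖cfc f e - Polynomial.aeval e p‖ ≤ δ := by
    rw [← cfc_polynomial p e, ← cfc_sub f p.eval e (hf.mono hsp)]
    refine norm_cfc_le hδ0.le fun t ht => ?_
    rw [Real.norm_eq_abs, abs_sub_comm]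
    exact (hpf t (hsp ht)).le
  have h2 : |f 1 - p.eval 1| ≤ δ := by
    rw [abs_sub_comm]
    exact (hpf 1 (by simp)).le
  have e1 : L (cfc f e) - f 1 • z = L (cfc f e - Polynomial.aeval e p) +
      ((L (Polynomial.aeval e p) - p.eval 1 • z) - (f 1 - p.eval 1) • z) := by
    rw [map_sub, sub_smul]
    abel
  have h3 : ‖L (cfc f e - Polynomial.aeval e p)‖ ≤ |κ| * δ :=
    (hL _).trans (mul_le_mul (le_abs_self κ) h1 (norm_nonneg _) (abs_nonneg _))
  have h4 : ‖(f 1 - p.eval 1) • z‖ ≤ δ * ‖z‖ := by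
    rw [norm_smul]
    gcongr
    exact h2
  have h5 : δ * (|κ| + ‖z‖ + 1) = ε / 2 := by
    rw [hδ]
    field_simp
  rw [e1]
  calc _ ≤ ‖L (cfc f e - Polynomial.aeval e p)‖ +
        (‖L (Polynomial.aeval e p) - p.eval 1 • z‖ + ‖(f 1 - p.eval 1) • z‖) :=
        (norm_add_le _ _).trans (add_le_add le_rfl (norm_sub_le _ _))
    _ < ε := by nlinarith

lemma tendsto_cfc_commutator (π : U →⋆ₐ[ℂ] V) (z : U) {f : ℝ → ℝ}
    (hf : ContinuousOn f (Set.Icc 0 1)) :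
    Tendsto (fun e => cfc f e * z - z * cfc f e) (quasicentralFilter π) (𝓝 0) := by
  have hl := eventually_mem_kerPosContraction π
  have := tendsto_of_forall_polynomial hl (z := 0) (κ := 2 * ‖z‖)
    (L := LinearMap.mulRight ℝ z - LinearMap.mulLeft ℝ z) (fun x => by
      have h1 := norm_mul_le x z
      have h2 := norm_mul_le z x
      refine (norm_sub_le _ _).trans ?_
      simp only [LinearMap.mulRight_apply, LinearMap.mulLeft_apply]
      linarith) (fun p => ?_) hf
  · simpa using this
  simp only [smul_zero, sub_zero, LinearMap.sub_apply, LinearMap.mulRight_apply,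
    LinearMap.mulLeft_apply]
  induction p using Polynomial.induction_on' with
  | add p q hp hq =>
    refine (by simpa using hp.add hq : Tendsto _ _ (𝓝 (0 : U))).congr fun e => ?_
    rw [map_add, add_mul, mul_add]
    abel
  | monomial n a =>
    have key : Tendsto (fun e : U => e ^ n * z - z * e ^ n) (quasicentralFilter π) (𝓝 0) := by
      induction n with
      | zero => simpa using tendsto_const_nhds
      | succ n ih =>
        have h1 := (tendsto_commutator_quasicentralFilter π z).norm
        have h2 := ih.norm
        rw [norm_zero] at h1 h2
        refine squeeze_zero_norm' ?_ (by simpa using h1.add h2)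
        filter_upwards [hl] with e he
        have hn := norm_le_one_of_mem_kerPosContraction he
        have hn' : ‖e ^ n‖ ≤ 1 := by
          rcases n.eq_zero_or_pos with rfl | h
          · simpa using (CStarAlgebra.norm_le_one_iff_of_nonneg (1 : U) zero_le_one).2 le_rfl
          · exact (norm_pow_le' e h).trans (pow_le_one₀ (norm_nonneg _) hn)
        have e1 : e ^ (n + 1) * z - z * e ^ (n + 1) =
            e ^ n * (e * z - z * e) + (e ^ n * z - z * e ^ n) * e := by
          rw [pow_succ]
          noncomm_ring
        rw [e1]
        refine (norm_add_le _ _).trans (add_le_add ?_ ?_)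
        · exact (norm_mul_le _ _).trans (mul_le_of_le_one_left (norm_nonneg _) hn')
        · exact (norm_mul_le _ _).trans (mul_le_of_le_one_right (norm_nonneg _) hn)
    refine (by simpa using key.const_smul a : Tendsto _ _ (𝓝 (0 : U))).congr fun e => ?_
    simp [Polynomial.aeval_monomial, smul_sub, ← Algebra.smul_def]

lemma tendsto_mul_cfc (π : U →⋆ₐ[ℂ] V) {z : U} (hz : π z = 0) {f : ℝ → ℝ}
    (hf : ContinuousOn f (Set.Icc 0 1)) :
    Tendsto (fun e => z * cfc f e - f 1 • z) (quasicentralFilter π) (𝓝 0) := by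
  have hl := eventually_mem_kerPosContraction π
  refine tendsto_of_forall_polynomial hl (z := z) (κ := ‖z‖) (L := LinearMap.mulLeft ℝ z)
    (fun x => norm_mul_le z x) (fun p => ?_) hf
  simp only [LinearMap.mulLeft_apply]
  induction p using Polynomial.induction_on' with
  | add p q hp hq =>
    refine (by simpa using hp.add hq : Tendsto _ _ (𝓝 (0 : U))).congr fun e => ?_
    rw [map_add, Polynomial.eval_add, add_smul, mul_add]
    abel
  | monomial n a =>
    have key : Tendsto (fun e : U => z * e ^ n - z) (quasicentralFilter π) (𝓝 0) := by
      induction n with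
      | zero => simpa using tendsto_const_nhds
      | succ n ih =>
        have h1 := (tendsto_sub_nhds_zero_iff.2 (tendsto_mul_quasicentralFilter π hz)).norm
        have h2 := ih.norm
        rw [norm_zero] at h1 h2
        refine squeeze_zero_norm' ?_ (by simpa using h2.add h1)
        filter_upwards [hl] with e he
        have hn := norm_le_one_of_mem_kerPosContraction he
        have e1 : z * e ^ (n + 1) - z = (z * e ^ n - z) * e + (z * e - z) := by
          rw [pow_succ]
          noncomm_ring
        rw [e1]
        refine (norm_add_le _ _).trans (add_le_add ?_ le_rfl)
        exact (norm_mul_le _ _).trans (mul_le_of_le_one_right (norm_nonneg _) hn)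
    refine (by simpa using key.const_smul a : Tendsto _ _ (𝓝 (0 : U))).congr fun e => ?_
    simp [Polynomial.aeval_monomial, smul_sub, ← Algebra.smul_def]

end Quasicentral

section Sandwich

variable {ι U : Type*} [Fintype ι] [CStarAlgebra U]

/-- The sum of the compressions of the `v i` by the `p i`. -/
def sandwich (p v : ι → U) : U := ∑ i, p i * v i * p i

lemma sandwich_add (p v w : ι → U) :
    sandwich p (fun i => v i + w i) = sandwich p v + sandwich p w := by
  simp [sandwich, mul_add, add_mul, Finset.sum_add_distrib]

lemma sandwich_smul (p v : ι → U) (c : ℂ) :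
    sandwich p (fun i => c • v i) = c • sandwich p v := by
  simp [sandwich, Finset.smul_sum]

lemma norm_sandwich_le_of_isSelfAdjoint [PartialOrder U] [StarOrderedRing U] {p v : ι → U}
    (hp : ∀ i, IsSelfAdjoint (p i))
    (hsum : ∑ i, p i * p i = 1) (hv : ∀ i, IsSelfAdjoint (v i)) {M : ℝ} (hM : 0 ≤ M)
    (hvM : ∀ i, ‖v i‖ ≤ M) : ‖sandwich p v‖ ≤ M := by
  have key : ∀ w : ι → U, (∀ i, IsSelfAdjoint (w i)) → (∀ i, ‖w i‖ ≤ M) →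
      sandwich p w ≤ algebraMap ℝ U M := fun w hw hwM => by
    have h1 : ∀ i, p i * w i * p i ≤ M • (p i * p i) := fun i => by
      have h2 : w i ≤ algebraMap ℝ U M :=
        (IsSelfAdjoint.le_algebraMap_norm_self (hw i)).trans (by
          rw [Algebra.algebraMap_eq_smul_one, Algebra.algebraMap_eq_smul_one]
          exact smul_le_smul_of_nonneg_right (hwM i) zero_le_one)
      have h3 := star_left_conjugate_le_conjugate h2 (p i)
      rw [(hp i).star_eq] at h3
      refine h3.trans_eq ?_
      rw [Algebra.algebraMap_eq_smul_one, mul_smul_comm, mul_one, smul_mul_assoc]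
    refine (Finset.sum_le_sum fun i _ => h1 i).trans_eq ?_
    rw [← Finset.smul_sum, hsum, Algebra.algebraMap_eq_smul_one]
  have hs : IsSelfAdjoint (sandwich p v) := by
    refine isSelfAdjoint_sum _ fun i _ => ?_
    have := (hv i).conjugate (p i)
    rwa [(hp i).star_eq] at this
  have h1 := key v hv hvM
  have h2 := key (fun i => - v i) (fun i => (hv i).neg) (by simpa using hvM)
  have e : sandwich p (fun i => - v i) = - sandwich p v := by
    simpa using sandwich_smul p v (-1)
  rw [e] at h2
  have h2' : algebraMap ℝ U (-M) ≤ sandwich p v := by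
    rw [map_neg]
    exact neg_le.1 h2
  rw [← cfc_id ℝ (sandwich p v)]
  refine norm_cfc_le hM fun t ht => abs_le.2 ⟨?_, ?_⟩
  · exact (algebraMap_le_iff_le_spectrum (ha := hs)).1 h2' t ht
  · exact (le_algebraMap_iff_spectrum_le (ha := hs)).1 h1 t ht

lemma norm_sandwich_le {p v : ι → U} (hp : ∀ i, IsSelfAdjoint (p i))
    (hsum : ∑ i, p i * p i = 1) {M : ℝ} (hM : 0 ≤ M) (hvM : ∀ i, ‖v i‖ ≤ M) :
    ‖sandwich p v‖ ≤ 2 * M := by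
  let _ := CStarAlgebra.spectralOrder U
  have _ := CStarAlgebra.spectralOrderedRing U
  have e : sandwich p v = sandwich p (fun i => (realPart (v i) : U)) +
      Complex.I • sandwich p (fun i => (imaginaryPart (v i) : U)) := by
    rw [← sandwich_smul, ← sandwich_add]
    congr with i
    exact (realPart_add_I_smul_imaginaryPart (v i)).symm
  rw [e]
  refine (norm_add_le _ _).trans ?_
  rw [norm_smul, Complex.norm_I, one_mul, two_mul]
  refine add_le_add ?_ ?_
  · exact norm_sandwich_le_of_isSelfAdjoint hp hsum (fun i => (realPart (v i)).2) hM fun i =>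
      (realPart.norm_le _).trans (hvM i)
  · exact norm_sandwich_le_of_isSelfAdjoint hp hsum (fun i => (imaginaryPart (v i)).2) hM fun i =>
      (imaginaryPart.norm_le _).trans (hvM i)

lemma sandwich_mul_sandwich_sub {p X Y Z R R' : ι → U} {W W' : ι → ι → U}
    (hcomm : ∀ i j, p i * p j = p j * p i) (hsum : ∑ i, p i * p i = 1)
    (hR : ∀ i, Z i - X i * Y i = R i + R' i) (hW : ∀ i j, Y j - Y i = W i j + W' i j) :
    sandwich p X * sandwich p Y - sandwich p Z =
      sandwich p (fun i => X i * sandwich p (W i)) - sandwich p R +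
      ((∑ i, ∑ j, p i * X i * (p j * ((p i * Y j - Y j * p i) * p j) + p j * (W' i j * (p j * p i)) +
        (p j * Y i - Y i * p j) * (p j * p i))) - ∑ i, p i * (R' i * p i)) := by
  have hZ : ∀ i, p i * Z i * p i = p i * X i * (Y i * p i) + p i * R i * p i + p i * (R' i * p i) :=
    fun i => by rw [sub_eq_iff_eq_add.1 (hR i)]; noncomm_ring
  have h1 : ∀ i j, p i * X i * p i * (p j * Y j * p j) =
      p i * X i * (Y i * (p j * p j) * p i) + p i * (X i * (p j * W i j * p j)) * p i +
      p i * X i * (p j * ((p i * Y j - Y j * p i) * p j) + p j * (W' i j * (p j * p i)) +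
        (p j * Y i - Y i * p j) * (p j * p i)) := fun i j => by
    have hy : Y j = Y i + W i j + W' i j := by rw [add_assoc, ← hW]; abel
    have e1 : p i * X i * p i * (p j * Y j * p j) = p i * X i * (p j * (p i * Y j) * p j) := by
      simp only [mul_assoc]
      rw [← mul_assoc (p i) (p j), hcomm i j]
      simp only [mul_assoc]
    have e2 : p j * (p i * Y j) * p j =
      p j * ((p i * Y j - Y j * p i) * p j) + p j * Y j * (p j * p i) := by
      rw [hcomm j i]; noncomm_ring
    rw [e1, e2, hy]
    noncomm_ring
  have h2 : sandwich p X * sandwich p Y = ∑ i, ∑ j, p i * X i * p i * (p j * Y j * p j) := by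
    rw [sandwich, sandwich, Finset.sum_mul_sum]
  have h3 : ∀ i, ∑ j, p i * X i * (Y i * (p j * p j) * p i) = p i * X i * (Y i * p i) := fun i => by
    rw [← Finset.mul_sum, ← Finset.sum_mul, ← Finset.mul_sum, hsum, mul_one]
  have h4 : ∀ i, ∑ j, p i * (X i * (p j * W i j * p j)) * p i =
      p i * (X i * sandwich p (W i)) * p i := fun i => by
    rw [sandwich, Finset.mul_sum, Finset.mul_sum, Finset.sum_mul]
  have h5 : sandwich p Z =
      ∑ i, p i * X i * (Y i * p i) + sandwich p R + ∑ i, p i * (R' i * p i) := by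
    simp only [sandwich, hZ, Finset.sum_add_distrib]
  rw [h2, h5]
  simp only [h1, Finset.sum_add_distrib, h3, h4]
  rw [sandwich, sandwich]
  abel

variable {V : Type*} [PartialOrder U] [StarOrderedRing U] [CStarAlgebra V]

lemma isBoundedUnder_norm_cfc {π : U →⋆ₐ[ℂ] V} {f : ℝ → ℝ}
    (hf : ∀ s ∈ Set.Icc (0 : ℝ) 1, |f s| ≤ 1) :
    IsBoundedUnder (· ≤ ·) (quasicentralFilter π) (norm ∘ fun e => cfc f e) :=
  ⟨1, eventually_map.2 <| (eventually_mem_kerPosContraction π).mono fun _ he =>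
    norm_cfc_le zero_le_one fun t ht => hf t (spectrum_subset_of_mem_kerPosContraction he ht)⟩

/-- A `cfc`-partition of unity -/
lemma sum_cfc_mul_cfc {π : U →⋆ₐ[ℂ] V} {c : ι → ℝ → ℝ}
    (hc : ∀ i, ContinuousOn (c i) (Set.Icc 0 1))
    (hsum : ∀ s ∈ Set.Icc (0 : ℝ) 1, ∑ i, c i s ^ 2 = 1)
    {e : U} (he : e ∈ kerPosContraction π) : ∑ i, cfc (c i) e * cfc (c i) e = 1 := by
  have hes : IsSelfAdjoint e := .of_nonneg he.1
  have hsp := spectrum_subset_of_mem_kerPosContraction he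
  have hc' := fun i => (hc i).mono hsp
  have : ∀ i, cfc (c i) e * cfc (c i) e = cfc (fun s => c i s ^ 2) e := fun i => by
    rw [← cfc_mul (c i) (c i) e (hc' i) (hc' i)]
    simp only [sq]
  simp_rw [this]
  rw [← cfc_sum_univ (fun i s => c i s ^ 2) e fun i => (hc' i).pow 2, ← cfc_const_one ℝ e]
  exact cfc_congr fun s hs => by simpa using hsum s (hsp hs)

lemma eventually_norm_sandwich_mul_sub_le (π : U →⋆ₐ[ℂ] V) {c : ι → ℝ → ℝ}
    (hc : ∀ i, ContinuousOn (c i) (Set.Icc 0 1))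
    (hsum : ∀ s ∈ Set.Icc (0 : ℝ) 1, ∑ i, c i s ^ 2 = 1)
    {X Y Z : ι → U} {K ε₁ ε₂ : ℝ} (h₁ : 0 ≤ ε₁) (h₂ : 0 ≤ ε₂) (hK : 0 ≤ K) (hX : ∀ i, ‖X i‖ ≤ K)
    (hR : ∀ i, ‖Z i - X i * Y i‖ ≤ ε₁ ∨ (c i 1 = 0 ∧ π (Z i - X i * Y i) = 0))
    (hW : ∀ i j, ‖Y j - Y i‖ ≤ ε₂ ∨ (∀ s ∈ Set.Icc (0 : ℝ) 1, c j s * c i s = 0) ∨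
      (c j 1 * c i 1 = 0 ∧ π (Y j - Y i) = 0)) {η : ℝ} (hη : 0 < η) :
    ∀ᶠ e in quasicentralFilter π, ‖sandwich (fun i => cfc (c i) e) X *
      sandwich (fun i => cfc (c i) e) Y - sandwich (fun i => cfc (c i) e) Z‖ ≤
        2 * ε₁ + 4 * K * ε₂ + η := by
  classical
  have hl := eventually_mem_kerPosContraction π
  have hc1 : ∀ i, ∀ s ∈ Set.Icc (0 : ℝ) 1, |c i s| ≤ 1 := fun i s hs => by
    rw [← sq_le_one_iff_abs_le_one, ← hsum s hs]
    exact Finset.single_le_sum (f := fun i => c i s ^ 2) (fun i _ => sq_nonneg _) (Finset.mem_univ i)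
  have hbd : ∀ i, IsBoundedUnder (· ≤ ·) (quasicentralFilter π) (norm ∘ fun e => cfc (c i) e) :=
    fun i => isBoundedUnder_norm_cfc (hc1 i)
  obtain ⟨R, R', hRR, hR1, hR2⟩ : ∃ R R' : ι → U, (∀ i, Z i - X i * Y i = R i + R' i) ∧
      (∀ i, ‖R i‖ ≤ ε₁) ∧ ∀ i, R' i = 0 ∨ (c i 1 = 0 ∧ π (R' i) = 0) := by
    choose R R' h using fun i => (by
      rcases hR i with h | h
      · exact ⟨Z i - X i * Y i, 0, by simp, h, .inl rfl⟩
      · exact ⟨0, Z i - X i * Y i, by simp, by simpa using h₁, .inr h⟩ :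
      ∃ R R' : U, Z i - X i * Y i = R + R' ∧ ‖R‖ ≤ ε₁ ∧ (R' = 0 ∨ (c i 1 = 0 ∧ π R' = 0)))
    exact ⟨R, R', fun i => (h i).1, fun i => (h i).2.1, fun i => (h i).2.2⟩
  obtain ⟨W, W', hWW, hW1, hW2⟩ : ∃ W W' : ι → ι → U, (∀ i j, Y j - Y i = W i j + W' i j) ∧
      (∀ i j, ‖W i j‖ ≤ ε₂) ∧ ∀ i j, W' i j = 0 ∨ (∀ s ∈ Set.Icc (0 : ℝ) 1, c j s * c i s = 0) ∨
        (c j 1 * c i 1 = 0 ∧ π (W' i j) = 0) := by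
    choose W W' h using fun i j => (by
      rcases hW i j with h | h | h
      · exact ⟨Y j - Y i, 0, by simp, h, .inl rfl⟩
      · exact ⟨0, Y j - Y i, by simp, by simpa using h₂, .inr (.inl h)⟩
      · exact ⟨0, Y j - Y i, by simp, by simpa using h₂, .inr (.inr h)⟩ :
      ∃ W W' : U, Y j - Y i = W + W' ∧ ‖W‖ ≤ ε₂ ∧ (W' = 0 ∨
        (∀ s ∈ Set.Icc (0 : ℝ) 1, c j s * c i s = 0) ∨ (c j 1 * c i 1 = 0 ∧ π W' = 0)))
    exact ⟨W, W', fun i j => (h i j).1, fun i j => (h i j).2.1, fun i j => (h i j).2.2⟩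
  have hRt : ∀ i, Tendsto (fun e => R' i * cfc (c i) e) (quasicentralFilter π) (𝓝 0) := fun i => by
    rcases hR2 i with h | ⟨h, h'⟩
    · simpa [h] using tendsto_const_nhds
    · simpa [h] using tendsto_mul_cfc π h' (hc i)
  have hWt : ∀ i j, Tendsto (fun e => W' i j * (cfc (c j) e * cfc (c i) e)) (quasicentralFilter π)
      (𝓝 0) := fun i j => by
    have hmul : ∀ᶠ e in quasicentralFilter π,
        cfc (c j) e * cfc (c i) e = cfc (fun s => c j s * c i s) e := hl.mono fun e he => by
      have hsp := spectrum_subset_of_mem_kerPosContraction he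
      exact (cfc_mul (c j) (c i) e ((hc j).mono hsp) ((hc i).mono hsp)).symm
    rcases hW2 i j with h | h | ⟨h, h'⟩
    · simpa [h] using tendsto_const_nhds
    · refine tendsto_const_nhds.congr' ?_
      filter_upwards [hmul, hl] with e he he'
      have hsp := spectrum_subset_of_mem_kerPosContraction he'
      rw [he, cfc_congr (g := fun _ => 0) fun s hs => h s (hsp hs), cfc_const_zero, mul_zero]
    · have := tendsto_mul_cfc π h' ((hc j).mul (hc i))
      simp only [Pi.mul_apply, h, zero_smul, sub_zero] at this
      refine this.congr' ?_
      filter_upwards [hmul] with e he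
      rw [he]
      rfl
  have hE : Tendsto (fun e => (∑ i, ∑ j, cfc (c i) e * X i *
      (cfc (c j) e * ((cfc (c i) e * Y j - Y j * cfc (c i) e) * cfc (c j) e) +
        cfc (c j) e * (W' i j * (cfc (c j) e * cfc (c i) e)) +
        (cfc (c j) e * Y i - Y i * cfc (c j) e) * (cfc (c j) e * cfc (c i) e))) -
        ∑ i, cfc (c i) e * (R' i * cfc (c i) e)) (quasicentralFilter π) (𝓝 0) := by
    have hb2 : ∀ i j, IsBoundedUnder (· ≤ ·) (quasicentralFilter π)
        (norm ∘ fun e => cfc (c j) e * cfc (c i) e) := fun i j =>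
      ⟨1, eventually_map.2 <| hl.mono fun e he => by
        have hsp := spectrum_subset_of_mem_kerPosContraction he
        refine (norm_mul_le _ _).trans (mul_le_one₀ ?_ (norm_nonneg _) ?_)
        · exact norm_cfc_le zero_le_one fun t ht => hc1 j t (hsp ht)
        · exact norm_cfc_le zero_le_one fun t ht => hc1 i t (hsp ht)⟩
    have hb3 : ∀ i, IsBoundedUnder (· ≤ ·) (quasicentralFilter π)
        (norm ∘ fun e => cfc (c i) e * X i) := fun i =>
      ⟨‖X i‖, eventually_map.2 <| hl.mono fun e he => by
        have hsp := spectrum_subset_of_mem_kerPosContraction he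
        refine (norm_mul_le _ _).trans (mul_le_of_le_one_left (norm_nonneg _) ?_)
        exact norm_cfc_le zero_le_one fun t ht => hc1 i t (hsp ht)⟩
    have t1 : ∀ i j, Tendsto (fun e => cfc (c j) e * ((cfc (c i) e * Y j - Y j * cfc (c i) e) *
        cfc (c j) e)) (quasicentralFilter π) (𝓝 0) := fun i j =>
      isBoundedUnder_le_mul_tendsto_zero (hbd j)
        ((tendsto_cfc_commutator π (Y j) (hc i)).zero_mul_isBoundedUnder_le (hbd j))
    have t2 : ∀ i j, Tendsto (fun e => cfc (c j) e * (W' i j * (cfc (c j) e * cfc (c i) e)))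
        (quasicentralFilter π) (𝓝 0) := fun i j =>
      isBoundedUnder_le_mul_tendsto_zero (hbd j) (hWt i j)
    have t3 : ∀ i j, Tendsto (fun e => (cfc (c j) e * Y i - Y i * cfc (c j) e) *
        (cfc (c j) e * cfc (c i) e)) (quasicentralFilter π) (𝓝 0) := fun i j =>
      (tendsto_cfc_commutator π (Y i) (hc j)).zero_mul_isBoundedUnder_le (hb2 i j)
    have t4 : ∀ i, Tendsto (fun e => cfc (c i) e * (R' i * cfc (c i) e))
        (quasicentralFilter π) (𝓝 0) := fun i =>
      isBoundedUnder_le_mul_tendsto_zero (hbd i) (hRt i)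
    have := (tendsto_finsetSum Finset.univ fun i _ => tendsto_finsetSum Finset.univ fun j _ =>
      isBoundedUnder_le_mul_tendsto_zero (hb3 i) (((t1 i j).add (t2 i j)).add (t3 i j) |> fun h => by
        simpa using h)).sub (tendsto_finsetSum Finset.univ fun i _ => t4 i)
    simpa using this
  filter_upwards [hl, NormedAddGroup.tendsto_nhds_zero.1 hE η hη] with e he hEe
  have hp : ∀ i, IsSelfAdjoint (cfc (c i) e) := fun i => cfc_predicate _ e
  have hsum' := sum_cfc_mul_cfc hc hsum he
  rw [sandwich_mul_sandwich_sub (fun i j => cfc_commute_cfc (c i) (c j) e) hsum' hRR hWW]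
  refine (norm_add_le _ _).trans (add_le_add ((norm_sub_le _ _).trans ?_) hEe.le)
  have b1 := norm_sandwich_le hp hsum' h₁ hR1
  have b2 : ‖sandwich (fun i => cfc (c i) e)
      (fun i => X i * sandwich (fun i => cfc (c i) e) (W i))‖ ≤ 2 * (K * (2 * ε₂)) :=
    norm_sandwich_le hp hsum' (by positivity) fun i => (norm_mul_le _ _).trans
      (mul_le_mul (hX i) (norm_sandwich_le hp hsum' h₂ (hW1 i)) (norm_nonneg _) hK)
  linarith

end Sandwich

section CompletelyPositive

variable {A B D Q : Type*} [NonUnitalCStarAlgebra A] [NonUnitalCStarAlgebra B]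
  [NonUnitalCStarAlgebra D] [NonUnitalCStarAlgebra Q]

lemma exists_sum_star_mul_self_eq {ι : Type*} (s : Finset ι) (x : ι → D) :
    ∃ z, ∑ i ∈ s, star (x i) * x i = star z * z := by
  let _ := CStarAlgebra.spectralOrder D
  have _ := CStarAlgebra.spectralOrderedRing D
  exact CStarAlgebra.nonneg_iff_eq_star_mul_self.1
    (Finset.sum_nonneg fun i _ => star_mul_self_nonneg (x i))

lemma IsCompletelyPositive.exists_star_mul_self {φ : A → D} (hφ : IsCompletelyPositive φ) (a : A) :
    ∃ d, φ (star a * a) = star d * d := by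
  obtain ⟨z, hz⟩ := hφ.2.2 1 (.of fun _ _ => star a * a) ⟨.of fun _ _ => a, by
    ext i j
    simp [Matrix.mul_apply, Matrix.star_apply]⟩
  refine ⟨z 0 0, ?_⟩
  have := congrFun (congrFun hz 0) 0
  simpa [Matrix.mul_apply, Matrix.star_apply] using this

section Ordered

variable [PartialOrder A] [StarOrderedRing A] [PartialOrder D] [StarOrderedRing D]

/-- A completely positive map as a positive linear map. -/
def IsCompletelyPositive.toPositiveLinearMap {φ : A → D} (hφ : IsCompletelyPositive φ) :
    A →ₚ[ℂ] D :=
  .mk₀ { toFun := φ, map_add' := hφ.1, map_smul' := hφ.2.1 } fun x hx => by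
    obtain ⟨a, rfl⟩ := CStarAlgebra.nonneg_iff_eq_star_mul_self.1 hx
    obtain ⟨d, hd⟩ := hφ.exists_star_mul_self a
    exact (star_mul_self_nonneg d).trans_eq hd.symm

end Ordered

lemma IsCompletelyPositive.map_star {φ : A → D} (hφ : IsCompletelyPositive φ) (a : A) :
    φ (star a) = star (φ a) := by
  let _ := CStarAlgebra.spectralOrder A
  have _ := CStarAlgebra.spectralOrderedRing A
  let _ := CStarAlgebra.spectralOrder D
  have _ := CStarAlgebra.spectralOrderedRing D
  exact StarHomClass.map_star hφ.toPositiveLinearMap a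

lemma IsCompletelyPositive.exists_norm_apply_le {φ : A → D} (hφ : IsCompletelyPositive φ) :
    ∃ C : ℝ, 0 ≤ C ∧ ∀ a, ‖φ a‖ ≤ C * ‖a‖ := by
  let _ := CStarAlgebra.spectralOrder A
  have _ := CStarAlgebra.spectralOrderedRing A
  let _ := CStarAlgebra.spectralOrder D
  have _ := CStarAlgebra.spectralOrderedRing D
  obtain ⟨C, hC⟩ := hφ.toPositiveLinearMap.exists_norm_apply_le
  exact ⟨C, C.2, hC⟩

/-- A completely positive map as a continuous linear map. -/
def IsCompletelyPositive.toCLM {φ : A → D} (hφ : IsCompletelyPositive φ) : A →L[ℂ] D :=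
  LinearMap.mkContinuousOfExistsBound { toFun := φ, map_add' := hφ.1, map_smul' := hφ.2.1 }
    (hφ.exists_norm_apply_le.imp fun _ h => h.2)

@[simp]
lemma IsCompletelyPositive.coe_toCLM {φ : A → D} (hφ : IsCompletelyPositive φ) :
    ⇑hφ.toCLM = φ := rfl

lemma IsCompletelyPositive.exists_bound {ι : Type*} {φ : ι → A → D}
    (hφ : ∀ i, IsCompletelyPositive (φ i)) (h : ∀ a, ∃ C : ℝ, ∀ i, ‖φ i a‖ ≤ C) :
    ∃ C : ℝ, 0 ≤ C ∧ ∀ i a, ‖φ i a‖ ≤ C * ‖a‖ := by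
  obtain ⟨C, hC⟩ := banach_steinhaus (g := fun i => (hφ i).toCLM) h
  exact ⟨|C|, abs_nonneg C, fun i a => (ContinuousLinearMap.le_of_opNorm_le _
    ((hC i).trans (le_abs_self C)) a)⟩

lemma IsCompletelyPositive.comp_starAlgHom {φ : B → D} (hφ : IsCompletelyPositive φ)
    (ψ : A →⋆ₙₐ[ℂ] B) : IsCompletelyPositive (fun a => φ (ψ a)) := by
  refine ⟨fun a b => by simp only [map_add, hφ.1], fun c a => by simp only [map_smul, hφ.2.1], ?_⟩
  rintro k _ ⟨y, rfl⟩
  obtain ⟨z, hz⟩ := hφ.2.2 k (star (y.map ψ) * y.map ψ) ⟨_, rfl⟩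
  refine ⟨z, hz ▸ ?_⟩
  ext i j
  simp [Matrix.mul_apply, Matrix.star_apply, map_sum, StarHomClass.map_star]

lemma IsCompletelyPositive.sum {ι : Type*} (s : Finset ι) {φ : ι → A → D}
    (hφ : ∀ i ∈ s, IsCompletelyPositive (φ i)) : IsCompletelyPositive (fun a => ∑ i ∈ s, φ i a) := by
  let _ := CStarAlgebra.spectralOrder D
  have _ := CStarAlgebra.spectralOrderedRing D
  refine ⟨fun a b => ?_, fun c a => ?_, fun k x hx => ?_⟩
  · rw [← Finset.sum_add_distrib]
    exact Finset.sum_congr rfl fun i hi => (hφ i hi).1 a b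
  · rw [Finset.smul_sum]
    exact Finset.sum_congr rfl fun i hi => (hφ i hi).2.1 c a
  · choose! z hz using fun i hi => (hφ i hi).2.2 k x hx
    obtain ⟨w, hw⟩ := exists_sum_star_mul_self_eq s fun i => CStarMatrix.ofMatrix (z i)
    refine ⟨CStarMatrix.ofMatrix.symm w, ?_⟩
    have e : x.map (fun a => ∑ i ∈ s, φ i a) = ∑ i ∈ s, star (z i) * z i := by
      rw [← Finset.sum_congr rfl hz]
      ext i j
      simp [Matrix.sum_apply]
    rw [e]
    exact hw

lemma IsCompletelyPositive.conjugate {φ : A → D} (hφ : IsCompletelyPositive φ)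
    {p : Unitization ℂ D} (hp : IsSelfAdjoint p) :
    IsCompletelyPositive (fun a => (p * (φ a : Unitization ℂ D) * p).snd) := by
  refine ⟨fun a b => ?_, fun c a => ?_, fun k x hx => ?_⟩
  · simp only [hφ.1, Unitization.inr_add, mul_add, add_mul, Unitization.snd_add]
  · simp only [hφ.2.1, Unitization.inr_smul, mul_smul_comm, smul_mul_assoc, Unitization.snd_smul]
  · obtain ⟨z, hz⟩ := hφ.2.2 k x hx
    have hin : ∀ d : D, ((((d : Unitization ℂ D) * p).snd : D) : Unitization ℂ D) = d * p :=
      fun d => by ext <;> simp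
    refine ⟨.of fun i j => ((z i j : Unitization ℂ D) * p).snd, ?_⟩
    ext i j
    have h1 : φ (x i j) = ∑ l, star (z l i) * z l j := by
      simpa [Matrix.mul_apply, Matrix.star_apply] using congrFun (congrFun hz i) j
    rw [Matrix.map_apply, Matrix.mul_apply]
    simp only [Matrix.star_apply]
    apply Unitization.inr_injective (R := ℂ)
    have h2 : ∀ d : D, ((((p * (d : Unitization ℂ D) * p).snd : D) : Unitization ℂ D)) =
      p * d * p := fun d => by ext <;> simp
    have h3 : ∀ g : Fin k → D, ((∑ l, g l : D) : Unitization ℂ D) = ∑ l, (g l : Unitization ℂ D) :=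
      fun g => map_sum (Unitization.inrNonUnitalStarAlgHom ℂ D) g _
    rw [h2, h1, h3, h3, Finset.mul_sum, Finset.sum_mul]
    refine Finset.sum_congr rfl fun l _ => ?_
    simp only [Matrix.of_apply, Unitization.inr_mul, Unitization.inr_star, hin,
      star_mul, hp.star_eq, mul_assoc]

end CompletelyPositive

section Compress

variable {A D Q ι : Type*} [Fintype ι]
  [NonUnitalCStarAlgebra D] [NonUnitalCStarAlgebra Q]

/-- The sum of the compressions of the maps `M i` by the elements `cfc (c i) e` of the
unitization. -/
def compress (c : ι → ℝ → ℝ) (M : ι → A → D) (e : Unitization ℂ D) (a : A) : D :=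
  (sandwich (fun i => cfc (c i) e) fun i => (M i a : Unitization ℂ D)).snd

lemma inr_compress (c : ι → ℝ → ℝ) (M : ι → A → D) (e : Unitization ℂ D) (a : A) :
    (Unitization.inr (compress c M e a) : Unitization ℂ D) =
      sandwich (fun i => cfc (c i) e) fun i => (M i a : Unitization ℂ D) := by
  refine Unitization.ext ?_ rfl
  rw [Unitization.fst_inr, sandwich]
  change 0 = Unitization.fstHom ℂ D _
  simp [map_sum]

lemma compress_eq_sum (c : ι → ℝ → ℝ) (M : ι → A → D) (e : Unitization ℂ D) (a : A) :
    compress c M e a = ∑ i, (cfc (c i) e * (M i a : Unitization ℂ D) * cfc (c i) e).snd :=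
  map_sum (Unitization.sndHom ℂ ℂ D) _ _

lemma isCompletelyPositive_compress [NonUnitalCStarAlgebra A] (c : ι → ℝ → ℝ) {M : ι → A → D}
    (hM : ∀ i, IsCompletelyPositive (M i)) (e : Unitization ℂ D) :
    IsCompletelyPositive (compress c M e) := by
  have := IsCompletelyPositive.sum Finset.univ fun i _ =>
    (hM i).conjugate (p := cfc (c i) e) (cfc_predicate (c i) e)
  simpa only [← compress_eq_sum] using this

variable [PartialOrder (Unitization ℂ D)] [StarOrderedRing (Unitization ℂ D)]
  {q : D →⋆ₙₐ[ℂ] Q} {e : Unitization ℂ D}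

lemma map_compress (he : e ∈ kerPosContraction (Unitization.starMap q)) {c : ι → ℝ → ℝ}
    (hc : ∀ i, ContinuousOn (c i) (Set.Icc 0 1)) (hsum : ∑ i, c i 0 ^ 2 = 1) {M : ι → A → D}
    {a : A} {d : Q} (hM : ∀ i, c i 0 ≠ 0 → q (M i a) = d) : q (compress c M e a) = d := by
  apply Unitization.inr_injective (R := ℂ)
  rw [← Unitization.starMap_inr, inr_compress, sandwich, map_sum]
  have h : ∀ i, Unitization.starMap q (cfc (c i) e * (M i a : Unitization ℂ D) * cfc (c i) e) =
      c i 0 ^ 2 • (d : Unitization ℂ Q) := fun i => by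
    rw [map_mul, map_mul, map_cfc_of_map_eq_zero (.of_nonneg he.1) he.2.2
      ((hc i).mono (spectrum_subset_of_mem_kerPosContraction he)), Unitization.starMap_inr,
      Algebra.algebraMap_eq_smul_one, smul_one_mul, mul_smul_comm, mul_one, smul_smul, ← sq]
    by_cases h0 : c i 0 = 0
    · simp [h0]
    · rw [hM i h0]
  rw [Finset.sum_congr rfl fun i _ => h i, ← Finset.sum_smul, hsum, one_smul]

lemma norm_compress_le (he : e ∈ kerPosContraction (Unitization.starMap q)) {c : ι → ℝ → ℝ}
    (hc : ∀ i, ContinuousOn (c i) (Set.Icc 0 1))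
    (hsum : ∀ s ∈ Set.Icc (0 : ℝ) 1, ∑ i, c i s ^ 2 = 1)
    {M : ι → A → D} {a : A} {K : ℝ} (hK : 0 ≤ K) (hM : ∀ i, ‖M i a‖ ≤ K) :
    ‖compress c M e a‖ ≤ 2 * K := by
  rw [← Unitization.norm_inr (𝕜 := ℂ), inr_compress]
  exact norm_sandwich_le (fun i => cfc_predicate _ e) (sum_cfc_mul_cfc hc hsum he) hK
    fun i => by rw [Unitization.norm_inr]; exact hM i

lemma eventually_norm_compress_mul_sub_le [Mul A] (q : D →⋆ₙₐ[ℂ] Q) {c : ι → ℝ → ℝ}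
    (hc : ∀ i, ContinuousOn (c i) (Set.Icc 0 1))
    (hsum : ∀ s ∈ Set.Icc (0 : ℝ) 1, ∑ i, c i s ^ 2 = 1)
    {M : ι → A → D} {x y : A} {K ε₁ ε₂ : ℝ} (h₁ : 0 ≤ ε₁) (h₂ : 0 ≤ ε₂) (hK : 0 ≤ K)
    (hx : ∀ i, ‖M i x‖ ≤ K)
    (hR : ∀ i, ‖M i (x * y) - M i x * M i y‖ ≤ ε₁ ∨
      (c i 1 = 0 ∧ q (M i (x * y)) = q (M i x) * q (M i y)))
    (hW : ∀ i j, ‖M j y - M i y‖ ≤ ε₂ ∨ (∀ s ∈ Set.Icc (0 : ℝ) 1, c j s * c i s = 0) ∨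
      (c j 1 * c i 1 = 0 ∧ q (M j y) = q (M i y))) {η : ℝ} (hη : 0 < η) :
    ∀ᶠ e in quasicentralFilter (Unitization.starMap q),
      ‖compress c M e (x * y) - compress c M e x * compress c M e y‖ ≤ 2 * ε₁ + 4 * K * ε₂ + η := by
  refine (eventually_norm_sandwich_mul_sub_le (Unitization.starMap q) hc hsum
    (X := fun i => (M i x : Unitization ℂ D)) (Y := fun i => (M i y : Unitization ℂ D))
    (Z := fun i => (M i (x * y) : Unitization ℂ D)) h₁ h₂ hK (fun i => ?_) (fun i => ?_)
    (fun i j => ?_) hη).mono fun e h => ?_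
  · rw [Unitization.norm_inr]; exact hx i
  · rw [← Unitization.inr_mul, ← Unitization.inr_sub, Unitization.norm_inr, Unitization.starMap_inr]
    refine (hR i).imp id fun h => ⟨h.1, ?_⟩
    rw [map_sub, map_mul, h.2, sub_self, Unitization.inr_zero]
  · rw [← Unitization.inr_sub, Unitization.norm_inr, Unitization.starMap_inr]
    refine (hW i j).imp id (.imp id fun h => ⟨h.1, ?_⟩)
    rw [map_sub, h.2, sub_self, Unitization.inr_zero]
  · rwa [← inr_compress, ← inr_compress, ← inr_compress, ← Unitization.inr_mul, ← Unitization.inr_sub,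
      Unitization.norm_inr, norm_sub_rev] at h

lemma norm_mul_mul_sub_le {U : Type*} [NonUnitalNormedRing U] {p p' v v' : U} {K δ ε : ℝ}
    (hp : ‖p‖ ≤ 1) (hp' : ‖p'‖ ≤ 1) (hv : ‖v‖ ≤ K) (hv' : ‖v'‖ ≤ K)
    (h : ‖p - p'‖ ≤ δ) (hvv : ‖v - v'‖ ≤ ε) :
    ‖p * v * p - p' * v' * p'‖ ≤ 2 * K * δ + ε := by
  have e : p * v * p - p' * v' * p' = (p - p') * v * p + p' * (v - v') * p + p' * v' * (p - p') := by
    noncomm_ring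
  have hK := (norm_nonneg _).trans hv
  have hδ := (norm_nonneg _).trans h
  have hε := (norm_nonneg _).trans hvv
  have b1 : ‖(p - p') * v * p‖ ≤ δ * K * 1 := by
    refine (norm_mul_le _ _).trans ?_
    gcongr
    exact (norm_mul_le _ _).trans (by gcongr)
  have b2 : ‖p' * (v - v') * p‖ ≤ 1 * ε * 1 := by
    refine (norm_mul_le _ _).trans ?_
    gcongr
    exact (norm_mul_le _ _).trans (by gcongr)
  have b3 : ‖p' * v' * (p - p')‖ ≤ 1 * K * δ := by
    refine (norm_mul_le _ _).trans ?_
    gcongr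
    exact (norm_mul_le _ _).trans (by gcongr)
  rw [e]
  refine (norm_add₃_le).trans ?_
  linarith

variable {T : Type*} [TopologicalSpace T]

lemma eventually_forall_norm_cfc_sub_le {U V : Type*} [CStarAlgebra U] [PartialOrder U]
    [StarOrderedRing U] [CStarAlgebra V] (π : U →⋆ₐ[ℂ] V) {c : T → ℝ → ℝ}
    (hc : Continuous (Function.uncurry c)) (t₀ : T) {ε : ℝ} (hε : 0 < ε) :
    ∀ᶠ t in 𝓝 t₀, ∀ e ∈ kerPosContraction π, ‖cfc (c t) e - cfc (c t₀) e‖ ≤ ε := by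
  have h : ∀ᶠ t in 𝓝 t₀, ∀ s ∈ Set.Icc (0 : ℝ) 1, ‖c t s - c t₀ s‖ < ε := by
    refine isCompact_Icc.eventually_forall_of_forall_eventually fun s _ => ?_
    have hcont : Continuous fun z : T × ℝ => ‖c z.1 z.2 - c t₀ z.2‖ :=
      (hc.sub (hc.comp (continuous_const.prodMk continuous_snd))).norm
    exact (hcont.tendsto (t₀, s)).eventually_lt_const (by simpa using hε)
  filter_upwards [h] with t ht e he
  have hsp := spectrum_subset_of_mem_kerPosContraction he
  have hct : ∀ t, Continuous (c t) := fun t => hc.comp (continuous_const.prodMk continuous_id)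
  rw [← cfc_sub _ _ e (hct t).continuousOn (hct t₀).continuousOn]
  exact norm_cfc_le hε.le fun s hs => (ht s (hsp hs)).le

lemma eventually_forall_norm_compress_sub_le (q : D →⋆ₙₐ[ℂ] Q) {c : T → ι → ℝ → ℝ}
    (hc : ∀ i, Continuous fun z : T × ℝ => c z.1 i z.2)
    (hc1 : ∀ t i, ∀ s ∈ Set.Icc (0 : ℝ) 1, |c t i s| ≤ 1)
    {M : T → ι → A → D} {a : A} (hM : ∀ i, Continuous fun t => M t i a) {t₀ : T} {ε : ℝ}
    (hε : 0 < ε) :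
    ∀ᶠ t in 𝓝 t₀, ∀ e ∈ kerPosContraction (Unitization.starMap q),
      ‖compress (c t) (M t) e a - compress (c t₀) (M t₀) e a‖ ≤ ε := by
  set n : ℝ := Fintype.card ι + 1 with hn
  have hn0 : 0 < n := by positivity
  set K : ℝ := ∑ i, ‖M t₀ i a‖ + 1 with hK
  have hs0 : 0 ≤ ∑ i, ‖M t₀ i a‖ := Finset.sum_nonneg fun i _ => norm_nonneg _
  have hK0 : 0 < K := by positivity
  have hMK : ∀ i, ‖M t₀ i a‖ < K := fun i => by
    have := Finset.single_le_sum (f := fun i => ‖M t₀ i a‖) (fun i _ => norm_nonneg _)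
      (Finset.mem_univ i)
    linarith
  have h1 : ∀ᶠ t in 𝓝 t₀, ∀ i, ‖M t i a‖ < K := eventually_all.2 fun i =>
    ((hM i).norm.tendsto t₀).eventually_lt_const (hMK i)
  have h2 : ∀ᶠ t in 𝓝 t₀, ∀ i, ‖M t i a - M t₀ i a‖ < ε / (2 * n) := eventually_all.2 fun i =>
    ((((hM i).sub continuous_const).norm).tendsto t₀).eventually_lt_const (by
      change ‖M t₀ i a - M t₀ i a‖ < _
      rw [sub_self, norm_zero]; positivity)
  have h3 := eventually_all.2 fun i => eventually_forall_norm_cfc_sub_le (Unitization.starMap q)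
    (c := fun t => c t i) (hc i) t₀ (ε := ε / (4 * K * n)) (by positivity)
  filter_upwards [h1, h2, h3] with t h1 h2 h3 e he
  rw [← Unitization.norm_inr (𝕜 := ℂ), Unitization.inr_sub, inr_compress, inr_compress, sandwich,
    sandwich, ← Finset.sum_sub_distrib]
  have hsp := spectrum_subset_of_mem_kerPosContraction he
  have hp : ∀ t i, ‖cfc (c t i) e‖ ≤ 1 := fun t i =>
    norm_cfc_le zero_le_one fun s hs => hc1 t i s (hsp hs)
  refine (norm_sum_le_of_le (n := fun _ => ε / n) _ fun i _ => ?_).trans ?_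
  · refine (norm_mul_mul_sub_le (K := K) (δ := ε / (4 * K * n)) (ε := ε / (2 * n)) (hp t i) (hp t₀ i)
      ?_ ?_ (h3 i e he) ?_).trans ?_
    · rw [Unitization.norm_inr]; exact (h1 i).le
    · rw [Unitization.norm_inr]; exact (hMK i).le
    · rw [← Unitization.inr_sub, Unitization.norm_inr]; exact (h2 i).le
    · apply le_of_eq
      field_simp
      ring
  · rw [Finset.sum_const, nsmul_eq_mul, Finset.card_univ, mul_div_assoc', div_le_iff₀ hn0, mul_comm]
    gcongr
    linarith

lemma continuousOn_compress (q : D →⋆ₙₐ[ℂ] Q) {c : ι → ℝ → ℝ}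
    (hc : ∀ i, ContinuousOn (c i) (Set.Icc 0 1)) (M : ι → A → D) (a : A) :
    ContinuousOn (fun e => compress c M e a) (kerPosContraction (Unitization.starMap q)) := by
  have h1 : ∀ i, ContinuousOn (cfc (c i)) (kerPosContraction (Unitization.starMap q)) := fun i =>
    (continuousOn_cfc (Unitization ℂ D) isCompact_Icc (c i) (hc i)).mono fun e he =>
      ⟨.of_nonneg he.1, spectrum_subset_of_mem_kerPosContraction he⟩
  rw [(Unitization.isometry_inr (𝕜 := ℂ) (A := D)).isEmbedding.isInducing.continuousOn_iff]
  simp only [Function.comp_def, inr_compress, sandwich]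
  exact continuousOn_finsetSum _ fun i _ => ((h1 i).mul continuousOn_const).mul (h1 i)

lemma continuous_compress (q : D →⋆ₙₐ[ℂ] Q) {c : T → ι → ℝ → ℝ}
    (hc : ∀ i, Continuous fun z : T × ℝ => c z.1 i z.2)
    (hc1 : ∀ t i, ∀ s ∈ Set.Icc (0 : ℝ) 1, |c t i s| ≤ 1)
    {M : T → ι → A → D} {a : A} (hM : ∀ i, Continuous fun t => M t i a) {e : T → Unitization ℂ D}
    (he : Continuous e) (hek : ∀ t, e t ∈ kerPosContraction (Unitization.starMap q)) :
    Continuous fun t => compress (c t) (M t) (e t) a := by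
  rw [continuous_iff_continuousAt]
  intro t₀
  have hct : ∀ i, Continuous (c t₀ i) := fun i => (hc i).comp (continuous_const.prodMk continuous_id)
  have h1 : Tendsto (fun t => compress (c t₀) (M t₀) (e t) a) (𝓝 t₀)
      (𝓝 (compress (c t₀) (M t₀) (e t₀) a)) :=
    ((continuousOn_compress q (fun i => (hct i).continuousOn) (M t₀) a).comp_continuous he
      hek).tendsto t₀
  have h2 : Tendsto (fun t => compress (c t) (M t) (e t) a - compress (c t₀) (M t₀) (e t) a) (𝓝 t₀)
      (𝓝 0) := by
    rw [Metric.tendsto_nhds]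
    intro ε hε
    filter_upwards [eventually_forall_norm_compress_sub_le q hc hc1 hM (t₀ := t₀) (half_pos hε)]
      with t ht
    rw [dist_zero_right]
    exact (ht _ (hek t)).trans_lt (half_lt_self hε)
  simpa [ContinuousAt] using h2.add h1

end Compress

section Coefficients

/-- The retraction of the real line onto the unit interval. -/
def clamp (x : ℝ) : ℝ := max 0 (min x 1)

lemma clamp_nonneg (x : ℝ) : 0 ≤ clamp x := le_max_left _ _

lemma clamp_le_one (x : ℝ) : clamp x ≤ 1 := max_le zero_le_one (min_le_right _ _)

lemma clamp_of_nonpos {x : ℝ} (h : x ≤ 0) : clamp x = 0 :=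
  max_eq_left ((min_le_left _ _).trans h)

lemma clamp_of_one_le {x : ℝ} (h : 1 ≤ x) : clamp x = 1 := by
  rw [clamp, min_eq_right h, max_eq_right zero_le_one]

lemma clamp_mono : Monotone clamp := fun _ _ h => max_le_max le_rfl (min_le_min h le_rfl)

@[fun_prop]
lemma continuous_clamp : Continuous clamp := by
  unfold clamp
  fun_prop

/-- Square roots of a partition of unity on the unit interval: the first function is supported near
`1`, the others form a partition into hats of width `r⁻¹` away from `1`. -/
def coeff (r : ℝ) : ℕ → ℝ → ℝ
  | 0, s => √(clamp (6 * s - 5))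
  | i + 1, s => √((clamp (r * s - i + 1) - clamp (r * s - i)) * (1 - clamp (6 * s - 5)))

lemma continuous_coeff (i : ℕ) : Continuous fun z : ℝ × ℝ => coeff z.1 i z.2 := by
  cases i <;> simp only [coeff] <;> fun_prop

lemma hat_nonneg (x : ℝ) : 0 ≤ clamp (x + 1) - clamp x :=
  sub_nonneg.2 (clamp_mono (by linarith))

lemma abs_coeff_le_one (r : ℝ) (i : ℕ) (s : ℝ) : |coeff r i s| ≤ 1 := by
  have h1 := clamp_nonneg (6 * s - 5)
  have h2 := clamp_le_one (6 * s - 5)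
  cases i with
  | zero =>
    rw [coeff, abs_of_nonneg (Real.sqrt_nonneg _), Real.sqrt_le_one]
    exact h2
  | succ i =>
    rw [coeff, abs_of_nonneg (Real.sqrt_nonneg _), Real.sqrt_le_one]
    have h3 := hat_nonneg (r * s - i)
    have h4 := clamp_nonneg (r * s - i)
    have h5 := clamp_le_one (r * s - i + 1)
    nlinarith

lemma sum_coeff_sq {r s : ℝ} (hr : 0 ≤ r) (hs : s ∈ Set.Icc (0 : ℝ) 1) {N : ℕ} (hN : r + 1 ≤ N) :
    ∑ i : Fin (N + 1), coeff r i s ^ 2 = 1 := by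
  have h1 := clamp_nonneg (6 * s - 5)
  have h2 := clamp_le_one (6 * s - 5)
  rw [Fin.sum_univ_eq_sum_range (fun i => coeff r i s ^ 2), Finset.sum_range_succ']
  have h : ∀ i : ℕ, coeff r (i + 1) s ^ 2 =
      (clamp (r * s - i + 1) - clamp (r * s - (i + 1 : ℕ) + 1)) * (1 - clamp (6 * s - 5)) :=
    fun i => by
      rw [coeff, Real.sq_sqrt (mul_nonneg (hat_nonneg _) (by linarith))]
      congr 3
      push_cast
      ring
  rw [Finset.sum_congr rfl fun i _ => h i, ← Finset.sum_mul,
    Finset.sum_range_sub' fun i : ℕ => clamp (r * s - i + 1), coeff, Real.sq_sqrt h1,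
    clamp_of_one_le, clamp_of_nonpos]
  · ring
  · nlinarith [hs.1, hs.2]
  · have := mul_nonneg hr hs.1
    push_cast
    linarith

lemma coeff_zero_eq_zero {r s : ℝ} (h : s ≤ 5 / 6) : coeff r 0 s = 0 := by
  rw [coeff, clamp_of_nonpos (by linarith), Real.sqrt_zero]

lemma coeff_succ_one (r : ℝ) (i : ℕ) : coeff r (i + 1) 1 = 0 := by
  rw [coeff, clamp_of_one_le (x := 6 * 1 - 5) (by norm_num), sub_self, mul_zero, Real.sqrt_zero]

lemma abs_lt_of_coeff_succ_ne_zero {r s : ℝ} {i : ℕ} (h : coeff r (i + 1) s ≠ 0) :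
    |r * s - i| < 1 := by
  contrapose! h
  have : clamp (r * s - i + 1) - clamp (r * s - i) = 0 := by
    rcases le_abs.1 h with h | h
    · rw [clamp_of_one_le h, clamp_of_one_le (by linarith), sub_self]
    · rw [clamp_of_nonpos (by linarith), clamp_of_nonpos (by linarith), sub_self]
  rw [coeff, this, zero_mul, Real.sqrt_zero]

end Coefficients

section Blend

variable {A D Q : Type*} [NonUnitalCStarAlgebra D] [NonUnitalCStarAlgebra Q]

/-- The maps `P (i / r)`, preceded by `G`. -/
def sampled (P : ℝ → A → D) (G : A → D) (r : ℝ) : ℕ → A → D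
  | 0 => G
  | i + 1 => P (i / r)

/-- The path `P` and the map `G`, blended along `e`. -/
def blend (P : ℝ → A → D) (G : A → D) (r : ℝ) (N : ℕ) (e : Unitization ℂ D) : A → D :=
  compress (fun i : Fin (N + 1) => coeff r i) (fun i => sampled P G r i) e

variable {P : ℝ → A → D} {G : A → D} {q : D →⋆ₙₐ[ℂ] Q}

lemma isCompletelyPositive_blend [NonUnitalCStarAlgebra A] (hP : ∀ s, IsCompletelyPositive (P s))
    (hG : IsCompletelyPositive G) (r : ℝ) (N : ℕ) (e : Unitization ℂ D) :
    IsCompletelyPositive (blend P G r N e) :=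
  isCompletelyPositive_compress _ (fun i => by
    rcases i with ⟨_ | i, hi⟩
    exacts [hG, hP _]) e

variable {T : Type*} [TopologicalSpace T]

lemma continuous_sampled {G : T → A → D} {r : T → ℝ} {a : A} (hP : Continuous fun s => P s a)
    (hG : Continuous fun t => G t a) (hr : Continuous r) (hr0 : ∀ t, r t ≠ 0) (i : ℕ) :
    Continuous fun t => sampled P (G t) (r t) i a := by
  cases i with
  | zero => exact hG
  | succ i => exact hP.comp (continuous_const.div hr hr0)

lemma continuousOn_coeff (r : ℝ) (i : ℕ) : ContinuousOn (coeff r i) (Set.Icc 0 1) :=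
  ((continuous_coeff i).comp (continuous_const.prodMk continuous_id)).continuousOn

variable [PartialOrder (Unitization ℂ D)] [StarOrderedRing (Unitization ℂ D)] {e : Unitization ℂ D}

lemma blend_eq_of_le (he : e ∈ kerPosContraction (Unitization.starMap q)) {r : ℝ} {N N' : ℕ}
    (hr : 0 ≤ r) (hN : r + 1 ≤ N) (hNN : N ≤ N') : blend P G r N e = blend P G r N' e := by
  ext a
  set v : ℕ → D := fun i =>
    (cfc (coeff r i) e * (Unitization.inr (sampled P G r i a) : Unitization ℂ D) *
      cfc (coeff r i) e).snd with hv
  rw [blend, blend, compress_eq_sum, compress_eq_sum, Fin.sum_univ_eq_sum_range v,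
    Fin.sum_univ_eq_sum_range v]
  refine Finset.sum_subset (Finset.range_mono (by lia)) fun i _ hi => ?_
  obtain ⟨i, rfl⟩ : ∃ i', i = i' + 1 := ⟨i - 1, by simp at hi; lia⟩
  have hi' : (N : ℝ) ≤ i := by simp at hi; exact_mod_cast hi
  have : cfc (coeff r (i + 1)) e = 0 := by
    rw [cfc_congr (g := fun _ => 0) fun s hs => ?_, cfc_const_zero]
    have hs' := spectrum_subset_of_mem_kerPosContraction he hs
    by_contra h
    have := (abs_lt.1 (abs_lt_of_coeff_succ_ne_zero h)).1
    nlinarith [hs'.1, hs'.2]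
  simp [hv, this]

lemma map_blend (he : e ∈ kerPosContraction (Unitization.starMap q)) {r : ℝ} (hr : 0 ≤ r) {N : ℕ}
    (hN : r + 1 ≤ N) (a : A) : q (blend P G r N e a) = q (P 0 a) := by
  refine map_compress (c := fun i : Fin (N + 1) => coeff r i) he (fun i => continuousOn_coeff r i)
    (sum_coeff_sq hr (s := 0) (by simp) hN)
    fun i hi => ?_
  rcases i with ⟨_ | i, hi'⟩
  · exact absurd (coeff_zero_eq_zero (by norm_num)) hi
  · have h := abs_lt_of_coeff_succ_ne_zero hi
    rw [mul_zero, zero_sub, abs_neg, Nat.abs_cast] at h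
    obtain rfl : i = 0 := by exact_mod_cast Nat.lt_one_iff.1 (by exact_mod_cast h)
    simp [sampled]

lemma norm_blend_le (he : e ∈ kerPosContraction (Unitization.starMap q)) {r : ℝ} (hr : 0 ≤ r)
    {N : ℕ} (hN : r + 1 ≤ N) {a : A} {K : ℝ} (hP : ∀ s, ‖P s a‖ ≤ K) (hG : ‖G a‖ ≤ K) :
    ‖blend P G r N e a‖ ≤ 2 * K := by
  refine norm_compress_le (c := fun i : Fin (N + 1) => coeff r i) he
    (fun i => continuousOn_coeff r i) (fun s hs => sum_coeff_sq hr hs hN)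
    ((norm_nonneg _).trans hG) fun i => ?_
  rcases i with ⟨_ | i, hi⟩
  exacts [hG, hP _]

lemma eventually_norm_blend_mul_sub_le [Mul A]
    (hPq : ∀ s x y, q (P s (x * y)) = q (P s x) * q (P s y))
    (hPG : ∀ s, 2 / 3 ≤ s → ∀ a, q (P s a) = q (G a)) {r : ℝ} (hr : 6 ≤ r) {N : ℕ} (hN : r + 1 ≤ N)
    {x y : A} {K ω : ℝ} (hPx : ∀ s, ‖P s x‖ ≤ K) (hGx : ‖G x‖ ≤ K)
    (hω : ∀ s s', |s - s'| ≤ 2 / r → ‖P s y - P s' y‖ ≤ ω) {η : ℝ} (hη : 0 < η) :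
    ∀ᶠ e in quasicentralFilter (Unitization.starMap q),
      ‖blend P G r N e (x * y) - blend P G r N e x * blend P G r N e y‖ ≤
        2 * ‖G (x * y) - G x * G y‖ + 4 * K * ω + η := by
  have hr0 : 0 < r := by linarith
  have hω0 : 0 ≤ ω := by simpa using hω 0 0 (by simp; positivity)
  have near1 : ∀ i : ℕ, (∀ s ∈ Set.Icc (0 : ℝ) 1, coeff r 0 s * coeff r (i + 1) s = 0) ∨
      2 / 3 ≤ i / r := fun i => by
    by_contra! h
    obtain ⟨⟨s, hs, h1⟩, h2⟩ := h
    have h3 : 5 / 6 < s := by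
      by_contra! h
      exact h1 (by rw [coeff_zero_eq_zero h, zero_mul])
    have h4 := (abs_lt.1 (abs_lt_of_coeff_succ_ne_zero (right_ne_zero_of_mul h1))).2
    rw [div_lt_iff₀ hr0] at h2
    nlinarith
  refine eventually_norm_compress_mul_sub_le q (c := fun i : Fin (N + 1) => coeff r i)
    (fun i => continuousOn_coeff r i)
    (fun s hs => sum_coeff_sq hr0.le hs hN) (norm_nonneg _) hω0 ((norm_nonneg _).trans hGx)
    (fun i => ?_) (fun i => ?_) (fun i j => ?_) hη
  · rcases i with ⟨_ | i, hi⟩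
    exacts [hGx, hPx _]
  · rcases i with ⟨_ | i, hi⟩
    exacts [.inl le_rfl, .inr ⟨coeff_succ_one r i, hPq _ x y⟩]
  · rcases i with ⟨_ | i, hi⟩ <;> rcases j with ⟨_ | j, hj⟩
    · exact .inl (by simpa [sampled] using hω0)
    · rcases near1 j with h | h
      · exact .inr (.inl fun s hs => by rw [mul_comm]; exact h s hs)
      · exact .inr (.inr ⟨by simp [coeff_succ_one], hPG _ h y⟩)
    · rcases near1 i with h | h
      · exact .inr (.inl h)
      · exact .inr (.inr ⟨by simp [coeff_succ_one], (hPG _ h y).symm⟩)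
    · by_cases h : ∀ s ∈ Set.Icc (0 : ℝ) 1, coeff r (j + 1) s * coeff r (i + 1) s = 0
      · exact .inr (.inl h)
      · push Not at h
        obtain ⟨s, -, h⟩ := h
        have h1 := abs_lt.1 (abs_lt_of_coeff_succ_ne_zero (left_ne_zero_of_mul h))
        have h2 := abs_lt.1 (abs_lt_of_coeff_succ_ne_zero (right_ne_zero_of_mul h))
        refine .inl (hω _ _ ?_)
        rw [← sub_div, abs_div, abs_of_pos hr0]
        gcongr
        exact abs_le.2 ⟨by linarith, by linarith⟩

lemma eventually_forall_norm_blend_sub_le (q : D →⋆ₙₐ[ℂ] Q) {G : T → A → D} {r : T → ℝ} {a : A}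
    (hP : Continuous fun s => P s a) (hG : Continuous fun t => G t a) (hr : Continuous r)
    (hr0 : ∀ t, r t ≠ 0) (N : ℕ) (t₀ : T) {ε : ℝ} (hε : 0 < ε) :
    ∀ᶠ t in 𝓝 t₀, ∀ e ∈ kerPosContraction (Unitization.starMap q),
      ‖blend P (G t) (r t) N e a - blend P (G t₀) (r t₀) N e a‖ ≤ ε :=
  eventually_forall_norm_compress_sub_le q (c := fun t (i : Fin (N + 1)) => coeff (r t) i)
    (M := fun t (i : Fin (N + 1)) => sampled P (G t) (r t) i)
    (fun i => (continuous_coeff i).comp ((hr.comp continuous_fst).prodMk continuous_snd))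
    (fun _ _ _ _ => abs_coeff_le_one _ _ _) (fun i => continuous_sampled hP hG hr hr0 i) hε

lemma continuous_blend (q : D →⋆ₙₐ[ℂ] Q) {G : T → A → D} {r : T → ℝ} {a : A}
    (hP : Continuous fun s => P s a) (hG : Continuous fun t => G t a) (hr : Continuous r)
    (hr0 : ∀ t, r t ≠ 0) (N : ℕ) {e : T → Unitization ℂ D}
    (he : Continuous e) (hek : ∀ t, e t ∈ kerPosContraction (Unitization.starMap q)) :
    Continuous fun t => blend P (G t) (r t) N (e t) a :=
  continuous_compress q (c := fun t (i : Fin (N + 1)) => coeff (r t) i)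
    (M := fun t (i : Fin (N + 1)) => sampled P (G t) (r t) i)
    (fun i => (continuous_coeff i).comp ((hr.comp continuous_fst).prodMk continuous_snd))
    (fun _ _ _ _ => abs_coeff_le_one _ _ _) (fun i => continuous_sampled hP hG hr hr0 i) he hek

end Blend

section Path

variable {U V : Type*} [CStarAlgebra U] [PartialOrder U] [StarOrderedRing U] [CStarAlgebra V]

lemma exists_continuous_forall_of_eventually_quasicentralFilter (π : U →⋆ₐ[ℂ] V) {E : ℕ → U → Prop}
    (hE : ∀ k, ∀ᶠ e in quasicentralFilter π, E k e) :
    ∃ γ : C(ℝ, U), ∀ x, γ x ∈ kerPosContraction π ∧ ∀ k : ℕ, k ≤ x → E k (γ x) := by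
  classical
  choose p _ hpE using fun k => (hasBasis_quasicentralFilter π).mem_iff.1 (hE k)
  let t : ℝ → Set U := fun x =>
    kerPosContraction π ∩ ⋂ k : {k : ℕ // (k : ℝ) ≤ x}, quasicentralSet π (p k)
  obtain ⟨γ, hγ⟩ := exists_continuous_forall_mem_convex_of_local_const (t := t)
    (fun x => (convex_kerPosContraction π).inter (convex_iInter
      fun k => convex_quasicentralSet π (p k)))
    fun x => by
      obtain ⟨c, hc⟩ := quasicentralSet_nonempty π ((Finset.range (⌈x + 1⌉₊ + 1)).sup p)
      refine ⟨c, (eventually_lt_nhds (lt_add_one x)).mono fun y hy =>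
        ⟨hc.1, Set.mem_iInter.2 fun ⟨k, hk⟩ => quasicentralSet_anti π (Finset.le_sup ?_) hc⟩⟩
      have : (k : ℝ) ≤ ⌈x + 1⌉₊ := (hk.trans hy.le).trans (Nat.le_ceil _)
      exact Finset.mem_range_succ_iff.2 (by exact_mod_cast this)
  exact ⟨γ, fun x => ⟨(hγ x).1, fun k hk => hpE k (Set.mem_iInter.1 (hγ x).2 ⟨k, hk⟩)⟩⟩

end Path

lemma UniformContinuous.exists_modulus {D : Type*} [NormedAddCommGroup D] {f : ℝ → D}
    (hf : UniformContinuous f) {C : ℝ} (hC : ∀ s, ‖f s‖ ≤ C) {δ : ℕ → ℝ}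
    (hδ : Tendsto δ atTop (𝓝 0)) :
    ∃ ω : ℕ → ℝ, Tendsto ω atTop (𝓝 0) ∧ ∀ k s s', |s - s'| ≤ δ k → ‖f s - f s'‖ ≤ ω k := by
  let I : ℕ → Type := fun k => {z : ℝ × ℝ // |z.1 - z.2| ≤ δ k}
  refine ⟨fun k => ⨆ z : I k, ‖f z.1.1 - f z.1.2‖, ?_, fun k s s' h => ?_⟩
  · rw [Metric.tendsto_atTop]
    intro ε hε
    obtain ⟨ρ, hρ, h⟩ := Metric.uniformContinuous_iff.1 hf (ε / 2) (half_pos hε)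
    obtain ⟨n, hn⟩ := eventually_atTop.1 (hδ.eventually_lt_const hρ)
    refine ⟨n, fun k hk => ?_⟩
    rw [Real.dist_0_eq_abs, abs_of_nonneg (Real.iSup_nonneg fun _ => norm_nonneg _)]
    refine (Real.iSup_le (fun z => ?_) (half_pos hε).le).trans_lt (half_lt_self hε)
    rw [← dist_eq_norm]
    exact (h (by rw [Real.dist_eq]; exact z.2.trans_lt (hn k hk))).le
  · refine le_ciSup (f := fun z : I k => ‖f z.1.1 - f z.1.2‖) ⟨C + C, ?_⟩ ⟨(s, s'), h⟩
    rintro _ ⟨z, rfl⟩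
    exact (norm_sub_le _ _).trans (add_le_add (hC _) (hC _))

lemma norm_mul_defect_sub_le {D : Type*} [NonUnitalNormedRing D] (c a b c' a' b' : D) :
    ‖c - a * b‖ ≤ ‖c' - a' * b'‖ + (‖c - c'‖ + ‖a - a'‖ * ‖b‖ + ‖a'‖ * ‖b - b'‖) := by
  have e : c - a * b = (c' - a' * b') + ((c - c') - (a - a') * b - a' * (b - b')) := by noncomm_ring
  rw [e]
  refine (norm_add_le _ _).trans (add_le_add le_rfl ((norm_sub_le _ _).trans (add_le_add
    ((norm_sub_le _ _).trans (add_le_add le_rfl (norm_mul_le _ _))) (norm_mul_le _ _))))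

lemma tendsto_norm_mul_sub_of_denseRange {A D T ι : Type*} [NonUnitalCStarAlgebra A]
    [NonUnitalCStarAlgebra D] {Ψ : T → A → D} {l : Filter T}
    (hcp : ∀ t, IsCompletelyPositive (Ψ t)) {K : ℝ} (hK : ∀ t a, ‖Ψ t a‖ ≤ K * ‖a‖) {x : ι → A}
    (hx : DenseRange x)
    (h : ∀ i i', Tendsto (fun t => ‖Ψ t (x i * x i') - Ψ t (x i) * Ψ t (x i')‖) l (𝓝 0)) (a b : A) :
    Tendsto (fun t => ‖Ψ t (a * b) - Ψ t a * Ψ t b‖) l (𝓝 0) := by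
  rcases isEmpty_or_nonempty T with _ | ⟨⟨t₀⟩⟩
  · simp [filter_eq_bot_of_isEmpty l]
  have hsub : ∀ t a b, ‖Ψ t a - Ψ t b‖ ≤ K * ‖a - b‖ := fun t a b => by
    rw [← (hcp t).coe_toCLM, ← map_sub]
    exact hK t _
  rw [Metric.tendsto_nhds]
  intro ε hε
  have hc : Continuous fun z : A × A => K * ‖a * b - z.1 * z.2‖ + K * ‖a - z.1‖ * (K * ‖b‖) +
      K * ‖z.1‖ * (K * ‖b - z.2‖) := by fun_prop
  obtain ⟨⟨i, i'⟩, hi⟩ := (hx.prodMap hx).exists_mem_open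
    (isOpen_lt hc (continuous_const (y := ε / 2))) ⟨(a, b), by simpa using hε⟩
  filter_upwards [(h i i').eventually_lt_const (half_pos hε)] with t ht
  rw [Real.dist_0_eq_abs, abs_norm]
  refine (norm_mul_defect_sub_le _ _ _ (Ψ t (x i * x i')) (Ψ t (x i)) (Ψ t (x i'))).trans_lt ?_
  have b1 := hsub t (a * b) (x i * x i')
  have b2 := mul_le_mul (hsub t a (x i)) (hK t b) (norm_nonneg _)
    ((norm_nonneg _).trans (hsub t a (x i)))
  have b3 := mul_le_mul (hK t (x i)) (hsub t b (x i')) (norm_nonneg _)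
    ((norm_nonneg _).trans (hK t (x i)))
  simp only [Set.mem_ofPred_eq, Prod.map_apply] at hi
  linarith

lemma IsCompact.eventually_forall_mem_of_forall_eventually {T U : Type*} [TopologicalSpace T]
    {S : Set T} (hS : IsCompact S) {l : Filter U} {p : T → U → Prop}
    (h : ∀ t ∈ S, ∀ᶠ z in 𝓝 t ×ˢ l, z.1 ∈ S → p z.1 z.2) : ∀ᶠ e in l, ∀ t ∈ S, p t e := by
  obtain ⟨S', hS', E, hE, h⟩ := mem_prod_iff.1 (hS.mem_nhdsSet_prod_of_forall h)
  filter_upwards [hE] with e he t ht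
  exact h (Set.mk_mem_prod (subset_of_mem_nhdsSet hS' ht) he) ht

section Core

variable {A D Q T : Type*} [NonUnitalCStarAlgebra A] [NonUnitalCStarAlgebra D]
  [NonUnitalCStarAlgebra Q] [PartialOrder (Unitization ℂ D)] [StarOrderedRing (Unitization ℂ D)]
  [TopologicalSpace T] {P : ℝ → A → D} {q : D →⋆ₙₐ[ℂ] Q}

lemma IsCompact.eventually_forall_norm_blend_mul_sub_le {S : Set T} (hS : IsCompact S)
    (hPc : ∀ a, Continuous fun s => P s a)
    (hPq : ∀ s x y, q (P s (x * y)) = q (P s x) * q (P s y)) {G : T → A → D}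
    (hGc : ∀ a, Continuous fun t => G t a) (hPG : ∀ s, 2 / 3 ≤ s → ∀ t a, q (P s a) = q (G t a))
    {r : T → ℝ} (hrc : Continuous r) (hr : ∀ t, 6 ≤ r t) {N : ℕ} (hN : ∀ t ∈ S, r t + 1 ≤ N)
    {x y : A} {K ω : ℝ} (hPx : ∀ s, ‖P s x‖ ≤ K) (hPy : ∀ s, ‖P s y‖ ≤ K)
    (hGx : ∀ t, ‖G t x‖ ≤ K) (hGy : ∀ t, ‖G t y‖ ≤ K)
    (hω : ∀ t ∈ S, ∀ s s', |s - s'| ≤ 2 / r t → ‖P s y - P s' y‖ ≤ ω) {η : ℝ} (hη : 0 < η) :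
    ∀ᶠ e in quasicentralFilter (Unitization.starMap q), ∀ t ∈ S,
      ‖blend P (G t) (r t) N e (x * y) - blend P (G t) (r t) N e x * blend P (G t) (r t) N e y‖ ≤
        2 * ‖G t (x * y) - G t x * G t y‖ + 4 * K * ω + η := by
  have hK : 0 ≤ K := (norm_nonneg _).trans (hPx 0)
  have hr0 : ∀ t, 0 < r t := fun t => by linarith [hr t]
  set ε : ℝ := η / (4 * (1 + 4 * K)) with hε
  have hε0 : 0 < ε := by positivity
  have hεη : ε * (1 + 4 * K) = η / 4 := by rw [hε]; field_simp
  refine hS.eventually_forall_mem_of_forall_eventually fun t₀ ht₀ => ?_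
  have hc := fun a => eventually_forall_norm_blend_sub_le q (hPc a) (hGc a) hrc
    (fun t => (hr0 t).ne') N t₀ hε0
  have hδ : ∀ᶠ t in 𝓝 t₀, ‖G t₀ (x * y) - G t₀ x * G t₀ y‖ <
      ‖G t (x * y) - G t x * G t y‖ + η / 8 := by
    have : Continuous fun t => ‖G t (x * y) - G t x * G t y‖ + η / 8 :=
      (((hGc _).sub ((hGc x).mul (hGc y))).norm).add continuous_const
    exact (this.tendsto t₀).eventually_const_lt (by linarith)
  have hp := eventually_norm_blend_mul_sub_le hPq (fun s hs => hPG s hs t₀) (hr t₀) (hN t₀ ht₀)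
    hPx (hGx t₀) (hω t₀ ht₀) (half_pos hη)
  have hev := (((hc (x * y)).and (hc x)).and ((hc y).and hδ)).prod_mk
    (hp.and (eventually_mem_kerPosContraction _))
  refine hev.mono fun z hz ht => ?_
  obtain ⟨t, e⟩ := z
  obtain ⟨⟨⟨hxy, hx⟩, hy, hδ⟩, hp, he⟩ := hz
  have bx := norm_blend_le (P := P) (G := G t₀) he (hr0 t₀).le (hN t₀ ht₀) hPx (hGx t₀)
  have hby := norm_blend_le (P := P) (G := G t) he (hr0 t).le (hN t ht) hPy (hGy t)
  refine (norm_mul_defect_sub_le _ _ _ (blend P (G t₀) (r t₀) N e (x * y))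
    (blend P (G t₀) (r t₀) N e x) (blend P (G t₀) (r t₀) N e y)).trans ?_
  have b1 := mul_le_mul (hx e he) hby (norm_nonneg _) hε0.le
  have b2 := mul_le_mul bx (hy e he) (norm_nonneg _) (by positivity)
  have b3 := hxy e he
  dsimp only at hp ⊢
  linarith

theorem exists_cp_asymptotic_lift [TopologicalSpace.SeparableSpace A] {j : T → ℝ}
    (hj : Continuous j) (hj0 : ∀ t, 0 ≤ j t)
    (hjc : ∀ k : ℕ, IsCompact (j ⁻¹' Set.Icc k (k + 1))) {l : Filter T} (hjl : Tendsto j l atTop)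
    {K : ℝ} (hPcp : ∀ s, IsCompletelyPositive (P s))
    (hPc : ∀ a, UniformContinuous fun s => P s a) (hPK : ∀ s a, ‖P s a‖ ≤ K * ‖a‖)
    (hPq : ∀ s x y, q (P s (x * y)) = q (P s x) * q (P s y)) {G : T → A → D}
    (hGcp : ∀ t, IsCompletelyPositive (G t)) (hGc : ∀ a, Continuous fun t => G t a)
    (hGK : ∀ t a, ‖G t a‖ ≤ K * ‖a‖)
    (hGm : ∀ a b, Tendsto (fun t => ‖G t (a * b) - G t a * G t b‖) l (𝓝 0))
    (hPG : ∀ s, 2 / 3 ≤ s → ∀ t a, q (P s a) = q (G t a)) :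
    ∃ Ψ : T → A → D, (∀ t, IsCompletelyPositive (Ψ t)) ∧ (∀ a, Continuous fun t => Ψ t a) ∧
      (∀ t a, ‖Ψ t a‖ ≤ 2 * (K * ‖a‖)) ∧ (∀ t a, q (Ψ t a) = q (P 0 a)) ∧
      ∀ a b, Tendsto (fun t => ‖Ψ t (a * b) - Ψ t a * Ψ t b‖) l (𝓝 0) := by
  cases isEmpty_or_nonempty T
  · exact ⟨fun _ _ => 0, isEmptyElim, fun _ => continuous_of_discreteTopology, isEmptyElim,
      isEmptyElim, fun _ _ => by simp [filter_eq_bot_of_isEmpty l]⟩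
  let x : ℕ → A := TopologicalSpace.denseSeq A
  let r : T → ℝ := fun t => j t + 6
  have hr : Continuous r := hj.add continuous_const
  have hr6 : ∀ t, 6 ≤ r t := fun t => by simp only [r]; linarith [hj0 t]
  have hr0 : ∀ t, 0 ≤ r t := fun t => by linarith [hr6 t]
  have hδ : Tendsto (fun k : ℕ => (2 : ℝ) / (k + 6)) atTop (𝓝 0) :=
    (tendsto_natCast_atTop_atTop.atTop_add tendsto_const_nhds).const_div_atTop 2
  choose ω hω0 hω using fun a => (hPc a).exists_modulus (fun s => hPK s a) hδ
  let L : ℕ → ℕ → ℝ := fun m m' => max (K * ‖x m‖) (K * ‖x m'‖)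
  let E : ℕ → Unitization ℂ D → Prop := fun k e => ∀ m ∈ Finset.range (k + 1),
    ∀ m' ∈ Finset.range (k + 1), ∀ t ∈ j ⁻¹' Set.Icc k (k + 1),
      ‖blend P (G t) (r t) (k + 8) e (x m * x m') -
        blend P (G t) (r t) (k + 8) e (x m) * blend P (G t) (r t) (k + 8) e (x m')‖ ≤
        2 * ‖G t (x m * x m') - G t (x m) * G t (x m')‖ + 4 * L m m' * ω (x m') k + 1 / (k + 1)
  obtain ⟨γ, hγ⟩ := exists_continuous_forall_of_eventually_quasicentralFilter
    (Unitization.starMap q) (E := E) fun k => by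
      simp only [E, Filter.eventually_all_finset]
      intro m _ m' _
      refine (hjc k).eventually_forall_norm_blend_mul_sub_le (fun a => (hPc a).continuous) hPq hGc
        hPG hr hr6 (fun t ht => ?_) (fun s => (hPK s _).trans (le_max_left _ _))
        (fun s => (hPK s _).trans (le_max_right _ _)) (fun t => (hGK t _).trans (le_max_left _ _))
        (fun t => (hGK t _).trans (le_max_right _ _)) (fun t ht s s' h => hω _ k s s' (h.trans ?_))
        (by positivity)
      · push_cast
        simp only [r]
        linarith [ht.2]
      · have := ht.1
        simp only [r]
        gcongr
  let N : T → ℕ := fun t => ⌊j t⌋₊ + 8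
  have hN : ∀ t, r t + 1 ≤ N t := fun t => by
    have := Nat.lt_floor_add_one (j t)
    simp only [r, N]
    push_cast
    linarith
  have hcp : ∀ t, IsCompletelyPositive (blend P (G t) (r t) (N t) (γ (j t))) := fun t =>
    isCompletelyPositive_blend hPcp (hGcp t) _ _ _
  have hK : ∀ t a, ‖blend P (G t) (r t) (N t) (γ (j t)) a‖ ≤ 2 * (K * ‖a‖) := fun t a =>
    norm_blend_le (hγ _).1 (hr0 t) (hN t) (fun s => hPK s a) (hGK t a)
  refine ⟨fun t => blend P (G t) (r t) (N t) (γ (j t)), hcp, fun a => ?_, hK,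
    fun t a => map_blend (hγ _).1 (hr0 t) (hN t) a, ?_⟩
  · refine continuous_iff_continuousAt.2 fun t₀ => ?_
    have hc := continuous_blend q (hPc a).continuous (hGc a) hr
      (fun t => by linarith [hr6 t]) (⌊j t₀⌋₊ + 9) (γ.continuous.comp hj) fun t => (hγ (j t)).1
    refine hc.continuousAt.congr ?_
    filter_upwards [(hj.tendsto t₀).eventually_lt_const (Nat.lt_floor_add_one (j t₀))] with t ht
    have : N t ≤ ⌊j t₀⌋₊ + 9 := by
      have : ⌊j t⌋₊ < ⌊j t₀⌋₊ + 1 := (Nat.floor_lt (hj0 t)).2 (by exact_mod_cast ht)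
      simp only [N]
      lia
    rw [Function.comp_apply, ← blend_eq_of_le (hγ (j t)).1 (hr0 t) (hN t) this]
  · have hdense : ∀ m m', Tendsto (fun t =>
        ‖blend P (G t) (r t) (N t) (γ (j t)) (x m * x m') -
          blend P (G t) (r t) (N t) (γ (j t)) (x m) * blend P (G t) (r t) (N t) (γ (j t)) (x m')‖)
        l (𝓝 0) := fun m m' => by
      have hfl : Tendsto (fun t => ⌊j t⌋₊) l atTop := tendsto_nat_floor_atTop.comp hjl
      have hlim : Tendsto (fun t => 2 * ‖G t (x m * x m') - G t (x m) * G t (x m')‖ +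
          4 * L m m' * ω (x m') ⌊j t⌋₊ + 1 / ((⌊j t⌋₊ : ℝ) + 1)) l (𝓝 0) := by
        simpa using (((hGm _ _).const_mul 2).add (((hω0 (x m')).comp hfl).const_mul _)).add
          (tendsto_one_div_add_atTop_nhds_zero_nat.comp hfl)
      refine squeeze_zero' (.of_forall fun _ => norm_nonneg _) ?_ hlim
      filter_upwards [hfl.eventually_ge_atTop (max m m')] with t ht
      exact (hγ (j t)).2 _ (Nat.floor_le (hj0 t)) m
        (Finset.mem_range_succ_iff.2 ((le_max_left _ _).trans ht)) m'
        (Finset.mem_range_succ_iff.2 ((le_max_right _ _).trans ht)) t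
        ⟨Nat.floor_le (hj0 t), (Nat.lt_floor_add_one _).le⟩
    exact tendsto_norm_mul_sub_of_denseRange hcp
      (fun t a => (hK t a).trans_eq (mul_assoc 2 K ‖a‖).symm)
      (TopologicalSpace.denseRange_denseSeq A) hdense

end Core

section Homotopy

variable {A B D Q T : Type*} [NonUnitalCStarAlgebra A] [NonUnitalCStarAlgebra B]
  [NonUnitalCStarAlgebra D] [NonUnitalCStarAlgebra Q]

/-- The *-homomorphism at time `s` of a homotopy. -/
def evalHom (Φ : A →⋆ₙₐ[ℂ] C(unitInterval, B)) (s : unitInterval) : A →⋆ₙₐ[ℂ] B where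
  toFun a := Φ a s
  map_smul' c a := by simp
  map_zero' := by simp
  map_add' a b := by simp
  map_mul' a b := by simp
  map_star' a := by simp [map_star]

theorem exists_cp_asymptotic_lift_of_homotopy [TopologicalSpace.SeparableSpace A]
    [TopologicalSpace T] {q : D →⋆ₙₐ[ℂ] Q} {α : B →⋆ₙₐ[ℂ] A} {β : A →⋆ₙₐ[ℂ] B}
    (hdom : AreHomotopic (α.comp β) (NonUnitalStarAlgHom.id ℂ A)) {f : A →⋆ₙₐ[ℂ] Q} {F : A → D}
    (hF : IsCompletelyPositive F) (hFf : ∀ a, q (F a) = f a) {j : T → ℝ}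
    (hj : Continuous j) (hj0 : ∀ t, 0 ≤ j t)
    (hjc : ∀ k : ℕ, IsCompact (j ⁻¹' Set.Icc k (k + 1))) {l : Filter T} (hjl : Tendsto j l atTop)
    {G : T → B → D} {K : ℝ} (hGcp : ∀ t, IsCompletelyPositive (G t))
    (hGc : ∀ b, Continuous fun t => G t b) (hGK : ∀ t b, ‖G t b‖ ≤ K * ‖b‖)
    (hGm : ∀ a b, Tendsto (fun t => ‖G t (a * b) - G t a * G t b‖) l (𝓝 0))
    (hGf : ∀ t b, q (G t b) = f (α b)) :
    ∃ Ψ : T → A → D, (∀ t, IsCompletelyPositive (Ψ t)) ∧ (∀ a, Continuous fun t => Ψ t a) ∧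
      (∀ a, ∃ C, ∀ t, ‖Ψ t a‖ ≤ C) ∧ (∀ t a, q (Ψ t a) = f a) ∧
      ∀ a b, Tendsto (fun t => ‖Ψ t (a * b) - Ψ t a * Ψ t b‖) l (𝓝 0) := by
  let _ := CStarAlgebra.spectralOrder (Unitization ℂ D)
  have _ := CStarAlgebra.spectralOrderedRing (Unitization ℂ D)
  obtain ⟨Φ, hΦ0, hΦ1⟩ := hdom
  obtain ⟨C, hC, hFC⟩ := hF.exists_norm_apply_le
  let τ : ℝ → unitInterval := fun s => Set.projIcc 0 1 zero_le_one (3 * s - 1)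
  have hτ : UniformContinuous τ :=
    (LipschitzWith.projIcc zero_le_one).uniformContinuous.comp
      ((uniformContinuous_const_smul (3 : ℝ)).sub uniformContinuous_const)
  have hτ0 : τ 0 = 0 := Set.projIcc_of_le_left _ (by norm_num)
  have hτ1 : ∀ s, 2 / 3 ≤ s → τ s = 1 := fun s hs => Set.projIcc_of_right_le _ (by linarith)
  have hPc : ∀ a, UniformContinuous fun s => F (evalHom Φ (τ s) a) := fun a =>
    hF.toCLM.uniformContinuous.comp
      ((CompactSpace.uniformContinuous_of_continuous (Φ a).continuous).comp hτ)
  have hPK : ∀ s a, ‖F (evalHom Φ (τ s) a)‖ ≤ max C K * ‖a‖ := fun s a =>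
    (hFC _).trans (mul_le_mul (le_max_left _ _) (NonUnitalStarAlgHom.norm_apply_le _ a)
      (norm_nonneg _) (hC.trans (le_max_left _ _)))
  have hGβ : ∀ t a, ‖G t (β a)‖ ≤ max C K * ‖a‖ := fun t a =>
    (hGK t _).trans (mul_le_mul (le_max_right _ _) (NonUnitalStarAlgHom.norm_apply_le _ a)
      (norm_nonneg _) (hC.trans (le_max_left _ _)))
  obtain ⟨Ψ, h1, h2, h3, h4, h5⟩ := exists_cp_asymptotic_lift (q := q)
    (P := fun s a => F (evalHom Φ (τ s) a)) (G := fun t a => G t (β a)) hj hj0 hjc hjl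
    (fun s => hF.comp_starAlgHom _) hPc hPK (fun s x y => by simp only [hFf, map_mul])
    (fun t => (hGcp t).comp_starAlgHom β) (fun a => hGc (β a)) hGβ
    (fun a b => by simpa only [map_mul] using hGm (β a) (β b))
    (fun s hs t a => by rw [hFf, hGf, hτ1 s hs]; exact congrArg f (hΦ1 a))
  refine ⟨Ψ, h1, h2, fun a => ⟨_, fun t => h3 t a⟩, fun t a => (h4 t a).trans ?_, h5⟩
  rw [hFf, hτ0]
  exact congrArg f (hΦ0 a)

end Homotopy

section Bound

variable {A D : Type*} [NonUnitalCStarAlgebra A] [NonUnitalCStarAlgebra D]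

lemma IsCompletelyPositive.norm_apply_mono [PartialOrder A] [StarOrderedRing A] {φ : A → D}
    (hφ : IsCompletelyPositive φ) {a b : A} (ha : 0 ≤ a) (hab : a ≤ b) : ‖φ a‖ ≤ ‖φ b‖ := by
  let _ := CStarAlgebra.spectralOrder D
  have _ := CStarAlgebra.spectralOrderedRing D
  have key : ∀ x : A, 0 ≤ x → 0 ≤ φ x := fun x hx => by
    obtain ⟨y, rfl⟩ := CStarAlgebra.nonneg_iff_eq_star_mul_self.1 hx
    obtain ⟨z, hz⟩ := hφ.exists_star_mul_self y
    rw [hz]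
    exact star_mul_self_nonneg z
  refine CStarAlgebra.norm_le_norm_of_nonneg_of_le (key a ha) (sub_nonneg.1 ?_)
  rw [← hφ.coe_toCLM, ← map_sub]
  exact key _ (sub_nonneg.2 hab)

lemma eventually_norm_le_of_asymptotically_multiplicative {T : Type*} {G : T → A → D} {l : Filter T}
    (hG : ∀ t, IsCompletelyPositive (G t))
    (hGm : ∀ a b, Tendsto (fun t => ‖G t (a * b) - G t a * G t b‖) l (𝓝 0)) (a : A) :
    ∃ C : ℝ, ∀ᶠ t in l, ‖G t a‖ ≤ C := by
  let _ := CStarAlgebra.spectralOrder A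
  have _ := CStarAlgebra.spectralOrderedRing A
  have contr : ∀ b : A, 0 ≤ b → ‖b‖ ≤ 1 → ∀ᶠ t in l, ‖G t b‖ ≤ 2 := fun b hb hb1 => by
    filter_upwards [(hGm b b).eventually_lt_const one_pos] with t ht
    have hsa : star (G t b) = G t b := by rw [← (hG t).map_star, hb.isSelfAdjoint.star_eq]
    have h1 : ‖G t b‖ * ‖G t b‖ = ‖G t b * G t b‖ := by
      rw [← CStarRing.norm_star_mul_self, hsa]
    have h2 : ‖G t (b * b)‖ ≤ ‖G t b‖ := by
      have hbb : 0 ≤ b * b := by simpa [hb.isSelfAdjoint.star_eq] using star_mul_self_nonneg b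
      refine (hG t).norm_apply_mono hbb (le_trans ?_ (smul_le_of_le_one_left hb hb1))
      obtain ⟨c, rfl⟩ := CStarAlgebra.nonneg_iff_eq_star_mul_self.1 hb
      simpa [mul_assoc, CStarRing.norm_self_mul_star, CStarRing.norm_star_mul_self] using
        CStarAlgebra.star_left_conjugate_le_norm_smul (a := c) (b := c * star c)
    have h3 : ‖G t b * G t b‖ ≤ ‖G t (b * b)‖ + 1 := by
      have := norm_sub_norm_le (G t b * G t b) (G t (b * b))
      rw [norm_sub_rev] at this
      linarith
    nlinarith [norm_nonneg (G t b)]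
  have pos : ∀ b : A, 0 ≤ b → ∃ C : ℝ, ∀ᶠ t in l, ‖G t b‖ ≤ C := fun b hb => by
    rcases eq_or_ne b 0 with rfl | h
    · exact ⟨0, .of_forall fun t => by rw [← (hG t).coe_toCLM, map_zero, norm_zero]⟩
    · refine ⟨‖b‖ * 2, ?_⟩
      have hn : 0 < ‖b‖ := norm_pos_iff.2 h
      filter_upwards [contr (((‖b‖⁻¹ : ℝ) : ℂ) • b) (by
        rw [Complex.coe_smul]; exact smul_nonneg (by positivity) hb) (by
        rw [norm_smul]; simp [hn.ne'])] with t ht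
      rw [(hG t).2.1, norm_smul] at ht
      simp only [Complex.norm_real, norm_inv, norm_norm] at ht
      rwa [inv_mul_le_iff₀ hn] at ht
  obtain ⟨x, hx0, hxa⟩ : ∃ x : Fin 4 → A, (∀ i, 0 ≤ x i) ∧
      a = ∑ i : Fin 4, Complex.I ^ (i : ℕ) • x i := by
    obtain ⟨x, hx, -, h⟩ := CStarAlgebra.exists_sum_four_nonneg a
    exact ⟨x, hx, h⟩
  choose C hC using fun i => pos (x i) (hx0 i)
  refine ⟨∑ i, C i, (eventually_all.2 hC).mono fun t ht => ?_⟩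
  rw [← (hG t).coe_toCLM, hxa, map_sum]
  refine (norm_sum_le _ _).trans (Finset.sum_le_sum fun i _ => ?_)
  rw [map_smul, norm_smul, norm_pow, Complex.norm_I, one_pow, one_mul]
  exact ht i

lemma IsAsymptoticHom.exists_bound {G : NNReal → A → D} (hG : IsAsymptoticHom G)
    (hcp : ∀ t, IsCompletelyPositive (G t)) : ∃ C : ℝ, 0 ≤ C ∧ ∀ t a, ‖G t a‖ ≤ C * ‖a‖ := by
  refine IsCompletelyPositive.exists_bound hcp fun a => ?_
  obtain ⟨C, hC⟩ := eventually_norm_le_of_asymptotically_multiplicative hcp hG.2.1 a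
  obtain ⟨t₀, ht₀⟩ := eventually_atTop.1 hC
  obtain ⟨C', hC'⟩ := (isCompact_Icc (a := 0) (b := t₀)).exists_bound_of_continuousOn
    (hG.1 a).continuousOn
  refine ⟨max C C', fun t => ?_⟩
  rcases le_total t₀ t with h | h
  · exact (ht₀ t h).trans (le_max_left _ _)
  · exact (hC' t ⟨zero_le, h⟩).trans (le_max_right _ _)

end Bound

/-- If `A` is homotopy dominated by `B` (there are ∗-homomorphisms `α : B → A`, `β : A → B`
with `α∘β` homotopic to `id_A`), and every ∗-homomorphism `B → D/I` admitting a cp lift lifts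
to a cp (discrete) asymptotic homomorphism `B → D`, then every ∗-homomorphism `A → D/I`
admitting a cp lift lifts to a cp (discrete) asymptotic homomorphism `A → D`.  Here the
quotient map `q : D → D/I` is modelled as a surjective ∗-homomorphism onto `Q`. -/
theorem cp_lifting_of_homotopy_dominated
    {A B D Q : Type*} [NonUnitalCStarAlgebra A] [NonUnitalCStarAlgebra B]
    [NonUnitalCStarAlgebra D] [NonUnitalCStarAlgebra Q]
    [TopologicalSpace.SeparableSpace A] [TopologicalSpace.SeparableSpace B]
    (q : D →⋆ₙₐ[ℂ] Q) (hq : Function.Surjective q)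
    (α : B →⋆ₙₐ[ℂ] A) (β : A →⋆ₙₐ[ℂ] B)
    (hdom : AreHomotopic (α.comp β) (NonUnitalStarAlgHom.id ℂ A)) :
    -- continuous version
    ((∀ g : B →⋆ₙₐ[ℂ] Q, (∃ G : B → D, IsCompletelyPositive G ∧ ∀ b, q (G b) = g b) →
        ∃ G : NNReal → B → D, IsAsymptoticHom G ∧ (∀ t, IsCompletelyPositive (G t)) ∧
          ∀ t b, q (G t b) = g b) →
      ∀ f : A →⋆ₙₐ[ℂ] Q, (∃ F : A → D, IsCompletelyPositive F ∧ ∀ a, q (F a) = f a) →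
        ∃ F : NNReal → A → D, IsAsymptoticHom F ∧ (∀ t, IsCompletelyPositive (F t)) ∧
          ∀ t a, q (F t a) = f a) ∧
    -- discrete version
    ((∀ g : B →⋆ₙₐ[ℂ] Q, (∃ G : B → D, IsCompletelyPositive G ∧ ∀ b, q (G b) = g b) →
        ∃ G : ℕ → B → D, IsDiscreteAsymptoticHom G ∧ (∀ n, IsCompletelyPositive (G n)) ∧
          ∀ n b, q (G n b) = g b) →
      ∀ f : A →⋆ₙₐ[ℂ] Q, (∃ F : A → D, IsCompletelyPositive F ∧ ∀ a, q (F a) = f a) →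
        ∃ F : ℕ → A → D, IsDiscreteAsymptoticHom F ∧ (∀ n, IsCompletelyPositive (F n)) ∧
          ∀ n a, q (F n a) = f a) := by
  refine ⟨fun H f ⟨F, hF, hFf⟩ => ?_, fun H f ⟨F, hF, hFf⟩ => ?_⟩
  · obtain ⟨G, hG, hGcp, hGf⟩ := H (f.comp α) ⟨_, hF.comp_starAlgHom α, fun _ => hFf _⟩
    obtain ⟨K, -, hK⟩ := hG.exists_bound hGcp
    obtain ⟨Ψ, hcp, hc, -, hf, hm⟩ := exists_cp_asymptotic_lift_of_homotopy
      (j := ((↑) : NNReal → ℝ)) hdom hF hFf NNReal.continuous_coe NNReal.coe_nonneg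
      (fun k => NNReal.isClosedEmbedding_coe.isCompact_preimage isCompact_Icc)
      (NNReal.tendsto_coe_atTop.2 tendsto_id) hGcp hG.1 hK hG.2.1 hGf
    exact ⟨Ψ, ⟨hc, hm, fun μ₁ μ₂ a b => by simp [(hcp _).1, (hcp _).2.1],
      fun a => by simp [(hcp _).map_star]⟩, hcp, hf⟩
  · obtain ⟨G, hG, hGcp, hGf⟩ := H (f.comp α) ⟨_, hF.comp_starAlgHom α, fun _ => hFf _⟩
    obtain ⟨K, -, hK⟩ := IsCompletelyPositive.exists_bound hGcp hG.2.2.2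
    obtain ⟨Ψ, hcp, -, hb, hf, hm⟩ := exists_cp_asymptotic_lift_of_homotopy (j := ((↑) : ℕ → ℝ))
      hdom hF hFf continuous_of_discreteTopology Nat.cast_nonneg
      (fun k => Nat.isClosedEmbedding_coe_real.isCompact_preimage isCompact_Icc)
      tendsto_natCast_atTop_atTop hGcp (fun _ => continuous_of_discreteTopology) hK hG.1 hGf
    exact ⟨Ψ, ⟨hm, fun μ₁ μ₂ a b => by simp [(hcp _).1, (hcp _).2.1],
      fun a => by simp [(hcp _).map_star], hb⟩, hcp, hf⟩

end
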